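/- arXiv:2207.01122 — 6 statements merged into one kernel-verified Lean document; each statement's English description precedes it below -/
import Mathlib

section
/- Let k be an algebraically closed field with char(k) ≠ 2 and let V be a 6-dimensional k-vector space. Let A ⊆ ⋀³V be a Lagrangian subspace (i.e. dim A = 10 and a∧a′ = 0 in ⋀⁶V for all a, a′ ∈ A) which contains no nonzero decomposable vector. Then there exists a 5-dimensional subspace V₅′ ⊆ V such that A ∩ ⋀³V₅′ = 0. -/
noncomputable section

/-- For a subspace `U` of `V`, the subspace `⋀ⁿU` of the exterior algebra of `V` spanned by
`n`-fold wedge products of elements of `U`.  Taking `U = ⊤` gives `⋀ⁿV`. -/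
def wedgePow {k V : Type*} [Field k] [AddCommGroup V] [Module k V]
    (U : Submodule k V) (n : ℕ) : Submodule k (ExteriorAlgebra k V) :=
  (Submodule.map (ExteriorAlgebra.ι k) U) ^ n

namespace ExteriorAlgebra

open Module

section Contraction

variable {k V : Type*} [Field k] [AddCommGroup V] [Module k V]

/-- Contraction of an element of the exterior algebra with a linear form. -/
abbrev contract : Dual k V →ₗ[k] ExteriorAlgebra k V →ₗ[k] ExteriorAlgebra k V :=
  CliffordAlgebra.contractLeft (Q := (0 : QuadraticForm k V))

theorem contract_ι_mul (d : Dual k V) (v : V) (x : ExteriorAlgebra k V) :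
    contract d (ι k v * x) = d v • x - ι k v * contract d x :=
  CliffordAlgebra.contractLeft_ι_mul _ _ _

theorem contract_ι (d : Dual k V) (v : V) :
    contract d (ι k v) = algebraMap k _ (d v) :=
  CliffordAlgebra.contractLeft_ι (0 : QuadraticForm k V) d v

theorem contract_algebraMap (d : Dual k V) (r : k) :
    contract d (algebraMap k (ExteriorAlgebra k V) r) = 0 :=
  CliffordAlgebra.contractLeft_algebraMap (0 : QuadraticForm k V) d r

theorem contract_comm (d d' : Dual k V) (x : ExteriorAlgebra k V) :
    contract d (contract d' x) = -contract d' (contract d x) :=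
  CliffordAlgebra.contractLeft_comm _ _ _

theorem contract_mul {n : ℕ} {x : ExteriorAlgebra k V} (hx : x ∈ ⋀[k]^n V) (d : Dual k V)
    (y : ExteriorAlgebra k V) :
    contract d (x * y) = contract d x * y + (-1 : k) ^ n • (x * contract d y) := by
  induction hx using Submodule.pow_induction_on_left' with
  | algebraMap r => simp [← Algebra.smul_def]
  | add x y i hx hy ihx ihy =>
    simp only [add_mul, map_add, ihx, ihy, smul_add]
    abel
  | mem_mul m hm i x hx ih =>
    obtain ⟨v, rfl⟩ := hm
    rw [mul_assoc, contract_ι_mul, ih, contract_ι_mul, Nat.succ_eq_add_one, pow_succ]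
    simp only [sub_mul, mul_add, smul_mul_assoc, mul_smul_comm, mul_assoc, mul_neg_one, neg_smul]
    abel

theorem contract_mem {n : ℕ} {x : ExteriorAlgebra k V} (hx : x ∈ ⋀[k]^(n + 1) V)
    (d : Dual k V) : contract d x ∈ ⋀[k]^n V := by
  have key : ∀ m : ℕ, ∀ y ∈ ⋀[k]^m V, m ≠ 0 → contract d y ∈ ⋀[k]^(m - 1) V := by
    intro m y hy
    induction hy using Submodule.pow_induction_on_left' with
    | algebraMap r => simp
    | add x y i hx hy ihx ihy =>
      intro h
      rw [map_add]
      exact add_mem (ihx h) (ihy h)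
    | mem_mul m hm i x hx ih =>
      intro _
      obtain ⟨v, rfl⟩ := hm
      rw [contract_ι_mul, Nat.succ_eq_add_one, Nat.add_sub_cancel]
      refine sub_mem (Submodule.smul_mem _ _ hx) ?_
      rcases i with _ | i
      · obtain ⟨r, rfl⟩ := Submodule.mem_one.1 (by simpa using hx)
        simp
      · have := Submodule.mul_mem_mul (LinearMap.mem_range_self (ι k) v) (ih (by simp))
        rwa [Nat.add_sub_cancel, ← pow_succ'] at this
  simpa using key _ x hx (by simp)

/-- The map induced by `v ↦ v - d v • w` is `x ↦ x - w ∧ (d ⌋ x)`. -/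
theorem map_id_sub_smulRight (d : Dual k V) (w : V) (x : ExteriorAlgebra k V) :
    map (LinearMap.id - d.smulRight w) x = x - ι k w * contract d x := by
  have key : ∀ (v : V) (y : ExteriorAlgebra k V),
      map (LinearMap.id - d.smulRight w) y = y - ι k w * contract d y →
      map (LinearMap.id - d.smulRight w) (ι k v * y) =
        ι k v * y - ι k w * contract d (ι k v * y) := by
    intro v y hy
    have hsq : ∀ z : ExteriorAlgebra k V, ι k w * (ι k w * z) = 0 := fun z => by
      rw [← mul_assoc, ι_sq_zero, zero_mul]
    have hswap : ι k v * (ι k w * contract d y) = -(ι k w * (ι k v * contract d y)) := by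
      rw [← mul_assoc, ← mul_assoc, eq_neg_of_add_eq_zero_left (ι_add_mul_swap v w), neg_mul]
    rw [map_mul, hy, map_apply_ι, contract_ι_mul]
    simp only [LinearMap.sub_apply, LinearMap.id_apply, LinearMap.smulRight_apply, map_sub,
      map_smul, sub_mul, mul_sub, smul_mul_assoc, mul_smul_comm, hsq, hswap, smul_zero]
    abel
  induction x using CliffordAlgebra.left_induction with
  | algebraMap r =>
    erw [AlgHom.commutes, contract_algebraMap, mul_zero, sub_zero]
  | add x y hx hy =>
    rw [map_add, hx, hy, map_add, mul_add]
    abel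
  | ι_mul x v hx => exact key v x hx

theorem map_zero_of_mem {n : ℕ} {x : ExteriorAlgebra k V} (hx : x ∈ ⋀[k]^(n + 1) V) :
    map (0 : V →ₗ[k] V) x = 0 := by
  rw [exteriorPower, pow_succ'] at hx
  induction hx using Submodule.mul_induction_on' with
  | mem_mul_mem m hm n hn =>
    obtain ⟨v, rfl⟩ := hm
    simp
  | add x _ y _ hx hy => rw [map_add, hx, hy, add_zero]

theorem eq_zero_of_contract_eq_zero [FiniteDimensional k V] {n : ℕ} {x : ExteriorAlgebra k V}
    (hx : x ∈ ⋀[k]^(n + 1) V) (h : ∀ d : Dual k V, contract d x = 0) : x = 0 := by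
  classical
  let b := Module.finBasis k V
  have key : ∀ s : Finset (Fin (finrank k V)),
      map (LinearMap.id - ∑ i ∈ s, (b.coord i).smulRight (b i)) x = x := by
    intro s
    induction s using Finset.induction_on with
    | empty => simp [map_id]
    | insert j s hj ih =>
      have hcomp : LinearMap.id - ∑ i ∈ insert j s, (b.coord i).smulRight (b i) =
          (LinearMap.id - ∑ i ∈ s, (b.coord i).smulRight (b i)) ∘ₗ
            (LinearMap.id - (b.coord j).smulRight (b j)) := by
        ext v
        have hzero : ∑ i ∈ s, b.repr (b j) i • b i = 0 :=
          Finset.sum_eq_zero fun i hi => by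
            rw [b.repr_self, Finsupp.single_eq_of_ne (ne_of_mem_of_not_mem hi hj), zero_smul]
        simp only [Finset.sum_insert hj, LinearMap.sub_apply, LinearMap.id_apply,
          LinearMap.add_apply, LinearMap.sum_apply, LinearMap.smulRight_apply, Basis.coord_apply,
          LinearMap.comp_apply, map_sub, map_smul, hzero, sub_zero]
        abel
      rw [hcomp, ← map_comp_map, AlgHom.comp_apply, map_id_sub_smulRight, h, mul_zero,
        sub_zero, ih]
  have hid : LinearMap.id - ∑ i, (b.coord i).smulRight (b i) = 0 := by
    ext v
    simp [b.sum_repr]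
  rw [← key Finset.univ, hid, map_zero_of_mem hx]

theorem exists_ι_eq_of_mem {x : ExteriorAlgebra k V} (hx : x ∈ ⋀[k]^1 V) : ∃ v, ι k v = x := by
  simpa [exteriorPower] using hx

theorem mul_comm_of_mem_sq {x : ExteriorAlgebra k V} (hx : x ∈ ⋀[k]^2 V)
    (y : ExteriorAlgebra k V) : x * y = y * x := by
  rw [exteriorPower, pow_two] at hx
  induction hx using Submodule.mul_induction_on' with
  | mem_mul_mem m hm n hn =>
    obtain ⟨u, rfl⟩ := hm
    obtain ⟨v, rfl⟩ := hn
    have hswap : ∀ a b : V, ι k a * ι k b = -(ι k b * ι k a) := fun a b =>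
      eq_neg_of_add_eq_zero_left (ι_add_mul_swap a b)
    induction y using CliffordAlgebra.left_induction with
    | algebraMap r => exact (Algebra.commutes r _).symm
    | add y z hy hz => rw [mul_add, hy, hz, add_mul]
    | ι_mul y w hy =>
      change _ * (ι k w * y) = ι k w * y * _
      rw [mul_assoc (ι k w), ← hy, ← mul_assoc, ← mul_assoc, mul_assoc (ι k u), hswap v w, mul_neg,
        ← mul_assoc, hswap u w]
      simp [mul_assoc]
  | add x _ z _ hx hz => rw [add_mul, hx, hz, mul_add]

/-- A trivector satisfying `(d ⌋ a) ∧ a = 0` for every linear form `d` satisfies the Plücker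
relations. -/
theorem contract_contract_mul_self (h2 : (2 : k) ≠ 0) {a : ExteriorAlgebra k V}
    (ha : a ∈ ⋀[k]^3 V) (h : ∀ d : Dual k V, contract d a * a = 0) (d d' : Dual k V) :
    contract d (contract d' a) * a = 0 := by
  have key : ∀ d d' : Dual k V,
      contract d (contract d' a) * a + contract d' a * contract d a = 0 := by
    intro d d'
    have := contract_mul (contract_mem ha d') d a
    rw [h, map_zero] at this
    simpa using this.symm
  have hcomm : contract d a * contract d' a = contract d' a * contract d a :=
    mul_comm_of_mem_sq (contract_mem ha d) _
  have h₁ := key d d'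
  have h₂ := key d' d
  rw [contract_comm, neg_mul, hcomm] at h₂
  have : (2 : k) • (contract d (contract d' a) * a) = 0 := by
    rw [two_smul]
    nth_rewrite 2 [neg_add_eq_zero.1 h₂]
    exact h₁
  exact (smul_eq_zero.1 this).resolve_left h2

/-- A trivector satisfying the Plücker relations is decomposable. -/
theorem exists_eq_ι_mul_ι_mul_ι [FiniteDimensional k V] {a : ExteriorAlgebra k V}
    (ha : a ∈ ⋀[k]^3 V) (ha0 : a ≠ 0)
    (h : ∀ d d' : Dual k V, contract d (contract d' a) * a = 0) :
    ∃ v₁ v₂ v₃ : V, a = ι k v₁ * ι k v₂ * ι k v₃ := by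
  obtain ⟨d, hd⟩ : ∃ d : Dual k V, contract d a ≠ 0 := by
    by_contra! H
    exact ha0 (eq_zero_of_contract_eq_zero ha H)
  obtain ⟨e, he⟩ : ∃ e : Dual k V, contract e (contract d a) ≠ 0 := by
    by_contra! H
    exact hd (eq_zero_of_contract_eq_zero (contract_mem ha d) H)
  obtain ⟨f, hf⟩ : ∃ f : Dual k V, contract f (contract e (contract d a)) ≠ 0 := by
    by_contra! H
    exact he (eq_zero_of_contract_eq_zero (contract_mem (contract_mem ha d) e) H)
  have hvec : ∀ p q : Dual k V, ∃ v, ι k v = contract p (contract q a) := fun p q =>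
    exists_ι_eq_of_mem (contract_mem (contract_mem ha q) p)
  have hrel : ∀ (p q r : Dual k V) (v : V), ι k v = contract p (contract q a) →
      r v • a = ι k v * contract r a := by
    intro p q r v hv
    have := contract_ι_mul r v a
    rw [hv, h, map_zero, ← hv] at this
    exact sub_eq_zero.1 this.symm
  obtain ⟨w₁, hw₁⟩ := hvec e d
  obtain ⟨w₂, hw₂⟩ := hvec f d
  obtain ⟨w₃, hw₃⟩ := hvec f e
  have hc₁ : f w₁ ≠ 0 := by
    intro H
    apply hf
    rw [← hw₁, contract_ι, H, map_zero]
  have hc₂ : e w₂ ≠ 0 := by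
    intro H
    apply hf
    rw [contract_comm, ← hw₂, contract_ι, H, map_zero, neg_zero]
  have hfw₂ : f w₂ = 0 := by
    have : contract f (ι k w₂) = 0 := by
      rw [hw₂]
      exact CliffordAlgebra.contractLeft_contractLeft _ _
    rwa [contract_ι, algebraMap_eq_zero_iff] at this
  have h₂ : e w₂ • contract f a = -(ι k w₂ * ι k w₃) := by
    rw [← map_smul, hrel f d e w₂ hw₂, contract_ι_mul, hfw₂, hw₃]
    simp
  refine ⟨(f w₁)⁻¹ • w₁, -(e w₂)⁻¹ • w₂, w₃, ?_⟩
  have h₁ : a = (f w₁)⁻¹ • (ι k w₁ * contract f a) := by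
    rw [← hrel e d f w₁ hw₁, inv_smul_smul₀ hc₁]
  have h₃ : contract f a = (e w₂)⁻¹ • -(ι k w₂ * ι k w₃) := by
    rw [← h₂, inv_smul_smul₀ hc₂]
  rw [h₁, h₃]
  simp [mul_assoc, smul_comm (f w₁)⁻¹]

theorem contract_eq_zero_of_mem_wedgePow {d : Dual k V} {n : ℕ} {x : ExteriorAlgebra k V}
    (hx : x ∈ wedgePow (LinearMap.ker d) n) : contract d x = 0 := by
  refine Submodule.pow_induction_on_left _ (C := fun y => contract d y = 0)
    (contract_algebraMap d) (fun x y hx hy => by rw [map_add, hx, hy, add_zero]) ?_ hx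
  rintro _ ⟨v, hv, rfl⟩ x hx
  rw [contract_ι_mul, hx, LinearMap.mem_ker.1 hv, zero_smul, mul_zero, sub_zero]

end Contraction

end ExteriorAlgebra

/-- If `f` has maximal rank in the pencil `f + t • g`, then `g` maps the kernel of `f` into the
range of `f`. -/
theorem LinearMap.apply_mem_range_of_finrank_range_le {k E F : Type*} [Field k] [Infinite k]
    [AddCommGroup E] [Module k E] [FiniteDimensional k E] [AddCommGroup F] [Module k F]
    {f g : E →ₗ[k] F}
    (h : ∀ t : k, Module.finrank k (range (f + t • g)) ≤ Module.finrank k (range f))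
    {a : E} (ha : f a = 0) : g a ∈ range f := by
  by_contra hga
  obtain ⟨W, hW⟩ := Submodule.exists_isCompl (ker f)
  let D : W × k →ₗ[k] F := (f ∘ₗ W.subtype).coprod (toSpanSingleton k F (g a))
  let G : W × k →ₗ[k] F := (g ∘ₗ W.subtype).coprod 0
  have hD : ker D = ⊥ := by
    rw [ker_eq_bot']
    rintro ⟨w, s⟩ hws
    have hws' : f w + s • g a = 0 := by simpa [D] using hws
    have hs : s = 0 := by
      by_contra hs
      apply hga
      refine ⟨-s⁻¹ • (w : E), ?_⟩
      rw [map_smul, eq_neg_of_add_eq_zero_left hws', smul_neg, neg_smul, neg_neg,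
        inv_smul_smul₀ hs]
    subst hs
    have hw : (w : E) ∈ ker f ⊓ W := ⟨by simpa using hws', w.2⟩
    rw [hW.inf_eq_bot, Submodule.mem_bot, Submodule.coe_eq_zero] at hw
    simp [hw]
  obtain ⟨L, hL⟩ := D.exists_leftInverse_of_injective hD
  let N : Module.End k (W × k) := L ∘ₗ G
  obtain ⟨μ, hμ⟩ := (((Module.End.finite_hasEigenvalue N).union
    (Set.finite_singleton 0)).infinite_compl).nonempty
  simp only [Set.mem_compl_iff, Set.mem_union, Set.mem_singleton_iff, not_or] at hμ
  obtain ⟨hμN, hμ0⟩ := hμ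
  let t : k := -μ⁻¹
  have ht : t ≠ 0 := by simpa [t] using hμ0
  have hinj : ker (D + t • G) = ⊥ := by
    rw [ker_eq_bot']
    intro x hx
    by_contra hx0
    apply hμN
    refine Module.End.hasEigenvalue_of_hasEigenvector (x := x)
      ⟨Module.End.mem_eigenspace_iff.2 ?_, hx0⟩
    have hLx : x + t • N x = 0 := by
      have := congrArg L hx
      rw [map_zero, add_apply, map_add, smul_apply, map_smul] at this
      rwa [← comp_apply L D, hL, id_apply] at this
    have : μ • (x + t • N x) = 0 := by rw [hLx, smul_zero]
    rw [smul_add, smul_smul, show μ * t = -1 by simp [t, hμ0], neg_one_smul] at this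
    exact (sub_eq_zero.1 (by rwa [sub_eq_add_neg])).symm
  have hle : range (D + t • G) ≤ range (f + t • g) := by
    rintro _ ⟨⟨w, s⟩, rfl⟩
    refine ⟨w + (s * t⁻¹) • a, ?_⟩
    simp only [D, G, add_apply, smul_apply, map_add, map_smul, ha, coprod_apply, comp_apply,
      Submodule.subtype_apply, toSpanSingleton_apply, zero_apply, zero_add, add_zero,
      smul_smul, mul_assoc, inv_mul_cancel₀ ht, mul_one]
    abel
  have h₁ := (Submodule.finrank_mono hle).trans (h t)
  rw [finrank_range_of_inj (ker_eq_bot.1 hinj), Module.finrank_prod, Module.finrank_self] at h₁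
  have h₂ := Submodule.finrank_add_eq_of_isCompl hW
  have h₃ := f.finrank_range_add_finrank_ker
  omega

/-- **O'Grady.** Over an algebraically closed field of characteristic `≠ 2`, if `A ⊆ ⋀³V`
(with `dim V = 6`) is a Lagrangian subspace containing no nonzero decomposable vector, then
there is a `5`-dimensional subspace `V₅′ ⊆ V` with `A ∩ ⋀³V₅′ = 0`. -/
theorem exists_five_dim_subspace_inf_wedge_eq_bot
    {k V : Type*} [Field k] [IsAlgClosed k] [AddCommGroup V] [Module k V]
    (hchar : ringChar k ≠ 2) (hdimV : Module.finrank k V = 6)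
    (A : Submodule k (ExteriorAlgebra k V))
    (hA3 : A ≤ wedgePow (⊤ : Submodule k V) 3)
    (hA10 : Module.finrank k A = 10)
    (hLag : ∀ a ∈ A, ∀ a' ∈ A, a * a' = 0)
    (hdec : ∀ v₁ v₂ v₃ : V,
      ExteriorAlgebra.ι k v₁ * ExteriorAlgebra.ι k v₂ * ExteriorAlgebra.ι k v₃ ∈ A →
      ExteriorAlgebra.ι k v₁ * ExteriorAlgebra.ι k v₂ * ExteriorAlgebra.ι k v₃ = 0) :
    ∃ V₅' : Submodule k V, Module.finrank k V₅' = 5 ∧ A ⊓ wedgePow V₅' 3 = ⊥ := by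
  have h2 : (2 : k) ≠ 0 := Ring.two_ne_zero hchar
  have : FiniteDimensional k V := Module.finite_of_finrank_eq_succ hdimV
  have : FiniteDimensional k A := Module.finite_of_finrank_eq_succ hA10
  have hA3' : ∀ a ∈ A, a ∈ ⋀[k]^3 V := fun a ha => by
    have := hA3 ha
    rwa [wedgePow, Submodule.map_top] at this
  by_contra! H
  have hker : ∀ d : Module.Dual k V, d ≠ 0 → ∃ a ∈ A, a ≠ 0 ∧ ExteriorAlgebra.contract d a = 0 := by
    intro d hd
    have hrank := Module.Dual.finrank_ker_add_one_of_ne_zero hd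
    obtain ⟨a, ha, ha0⟩ := Submodule.exists_mem_ne_zero_of_ne_bot
      (H (LinearMap.ker d) (by omega))
    exact ⟨a, ha.1, ha0, ExteriorAlgebra.contract_eq_zero_of_mem_wedgePow ha.2⟩
  let C : Module.Dual k V →ₗ[k] A →ₗ[k] ExteriorAlgebra k V :=
    LinearMap.lcomp k _ A.subtype ∘ₗ ExteriorAlgebra.contract
  obtain ⟨d, hd, hmax⟩ : ∃ d : Module.Dual k V, d ≠ 0 ∧
      ∀ e, Module.finrank k (LinearMap.range (C e)) ≤ Module.finrank k (LinearMap.range (C d)) := by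
    have : Nontrivial V := Module.nontrivial_of_finrank_pos (R := k) (by omega)
    obtain ⟨d₀, hd₀⟩ := exists_ne (0 : Module.Dual k V)
    let S : Set ℕ := (fun e => Module.finrank k (LinearMap.range (C e))) '' {e | e ≠ 0}
    have hS : BddAbove S := by
      refine ⟨10, ?_⟩
      rintro _ ⟨e, -, rfl⟩
      exact hA10 ▸ LinearMap.finrank_range_le (C e)
    obtain ⟨d, hd, hdS⟩ := Nat.sSup_mem (s := S) ⟨_, d₀, hd₀, rfl⟩ hS
    refine ⟨d, hd, fun e => ?_⟩
    by_cases he : e = 0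
    · rw [he, map_zero, LinearMap.range_zero, finrank_bot]
      exact Nat.zero_le _
    · exact (le_csSup hS ⟨e, he, rfl⟩).trans hdS.ge
  obtain ⟨a, haA, ha0, hda⟩ := hker d hd
  have hsq : ∀ e : Module.Dual k V, ExteriorAlgebra.contract e a * a = 0 := by
    intro e
    obtain ⟨⟨b, hbA⟩, hb⟩ := LinearMap.apply_mem_range_of_finrank_range_le (f := C d) (g := C e)
      (fun t => by rw [← map_smul, ← map_add]; exact hmax _) (a := ⟨a, haA⟩) hda
    have hb : ExteriorAlgebra.contract d b = ExteriorAlgebra.contract e a := hb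
    have := ExteriorAlgebra.contract_mul (hA3' b hbA) d a
    rwa [hLag b hbA a haA, hda, mul_zero, smul_zero, add_zero, hb, map_zero, eq_comm] at this
  obtain ⟨v₁, v₂, v₃, rfl⟩ := ExteriorAlgebra.exists_eq_ι_mul_ι_mul_ι (hA3' a haA) ha0
    (ExteriorAlgebra.contract_contract_mul_self h2 (hA3' a haA) hsq)
  exact ha0 (hdec v₁ v₂ v₃ haA)
end
end

section
/- Let k be a field with char(k) ≠ 2 and let V be a 6-dimensional k-vector space. Let A ⊆ ⋀³V be a Lagrangian subspace containing no nonzero decomposable vector. Then the annihilator A⊥ = {ξ ∈ ⋀³(V∨) : ⟨ξ, a⟩ = 0 for all a ∈ A} contains no nonzero decomposable vector of ⋀³(V∨), i.e. no nonzero element of the form φ₁∧φ₂∧φ₃ with φᵢ ∈ V∨. -/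
noncomputable section

section Wedge

open Module Set Set.powersetCard ExteriorAlgebra

variable {k V : Type*} [Field k] [AddCommGroup V] [Module k V]

/-- The linear form on the exterior algebra which is the determinant with respect to `b` in top
degree and vanishes in all other degrees. -/
def topForm {n : ℕ} (b : Basis (Fin n) k V) : ExteriorAlgebra k V →ₗ[k] k :=
  liftAlternating (Pi.single n b.det)

lemma topForm_ιMulti {n : ℕ} (b : Basis (Fin n) k V) (v : Fin n → V) :
    topForm b (ιMulti k n v) = b.det v := by
  simp [topForm]

lemma topForm_basis_ne_zero {n : ℕ} (b : Basis (Fin n) k V) (s : powersetCard (Fin n) n) :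
    topForm b (ιMulti_family k n b s) ≠ 0 := by
  rw [ιMulti_family, topForm_ιMulti]
  let σ : Equiv.Perm (Fin n) := Equiv.ofBijective (ofFinEmbEquiv.symm s)
    (Finite.injective_iff_bijective.mp (ofFinEmbEquiv.symm s).injective)
  have h : b.det (b ∘ ofFinEmbEquiv.symm s) = b.det (b ∘ σ) := rfl
  rw [h, AlternatingMap.map_perm, Basis.det_self]
  exact (smul_ne_zero_iff_ne _).mpr one_ne_zero

lemma eq_zero_of_topForm_mul_eq_zero {m n : ℕ} (b : Basis (Fin (m + n)) k V)
    {x : ExteriorAlgebra k V} (hx : x ∈ ⋀[k]^m V)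
    (h : ∀ y ∈ ⋀[k]^n V, topForm b (x * y) = 0) : x = 0 := by
  suffices (⟨x, hx⟩ : ⋀[k]^m V) = 0 from congrArg Subtype.val this
  refine (b.exteriorPower m).ext_elem fun s => ?_
  have hcard : n + m = Fintype.card (Fin (m + n)) := by simp [add_comm]
  let t : powersetCard (Fin (m + n)) n := Set.powersetCard.compl hcard s
  have hst : Disjoint s.val t.val := disjoint_compl_right
  have hsum : x = ∑ r, (b.exteriorPower m).repr ⟨x, hx⟩ r • ιMulti_family k m b r := by
    conv_lhs => rw [show x = ((⟨x, hx⟩ : ⋀[k]^m V) : ExteriorAlgebra k V) from rfl,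
      ← (b.exteriorPower m).sum_repr ⟨x, hx⟩]
    simp
  have hzero := h (ιMulti_family k n b t) (ιMulti_range k n ⟨_, rfl⟩)
  rw [hsum, Finset.sum_mul, Finset.sum_eq_single s, smul_mul_assoc,
    ιMulti_family_mul_of_disjoint k b s t hst, map_smul, Units.smul_def, map_zsmul,
    ← Units.smul_def] at hzero
  · rw [map_zero, Finsupp.zero_apply]
    exact (smul_eq_zero.mp hzero).resolve_right
      ((smul_ne_zero_iff_ne _).mpr (topForm_basis_ne_zero b _))
  · intro r _ hr
    rw [smul_mul_assoc, ιMulti_family_mul_of_not_disjoint, smul_zero]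
    intro hd
    refine hr (eq_iff_subset.mpr fun i hi => ?_)
    simpa [t] using Finset.disjoint_left.mp hd hi
  · simp

/-- The bilinear form `(x, y) ↦ x ∧ y` on `⋀ᵐV`, read off through `topForm`. -/
def wedgeForm {m : ℕ} (b : Basis (Fin (m + m)) k V) : LinearMap.BilinForm k (⋀[k]^m V) :=
  ((LinearMap.mul k (ExteriorAlgebra k V)).compr₂ (topForm b)).domRestrict₁₂ _ _

lemma wedgeForm_apply {m : ℕ} (b : Basis (Fin (m + m)) k V) (x y : ⋀[k]^m V) :
    wedgeForm b x y = topForm b (x * y : ExteriorAlgebra k V) := rfl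

lemma ker_wedgeForm {m : ℕ} (b : Basis (Fin (m + m)) k V) : (wedgeForm b).ker = ⊥ := by
  refine LinearMap.ker_eq_bot'.mpr fun x hx => Subtype.ext ?_
  refine eq_zero_of_topForm_mul_eq_zero b x.2 fun y hy => ?_
  simpa [wedgeForm_apply] using LinearMap.congr_fun hx ⟨y, hy⟩

/-- A half-dimensional isotropic subspace of `⋀ᵐV` is its own orthogonal complement. -/
lemma mem_of_isotropic {m : ℕ} (b : Basis (Fin (m + m)) k V)
    {A : Submodule k (ExteriorAlgebra k V)} (hA : A ≤ ⋀[k]^m V)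
    (hdim : 2 * finrank k A = finrank k (⋀[k]^m V))
    (hiso : ∀ a ∈ A, ∀ a' ∈ A, a * a' = 0)
    {w : ExteriorAlgebra k V} (hw : w ∈ ⋀[k]^m V) (h : ∀ a ∈ A, topForm b (a * w) = 0) :
    w ∈ A := by
  have : Module.Finite k V := .of_basis b
  let A' : Submodule k (⋀[k]^m V) := A.submoduleOf _
  have hA' : finrank k A' = finrank k A := (Submodule.submoduleOfEquivOfLe hA).finrank_eq
  have horth := (wedgeForm b).finrank_add_finrank_orthogonal' A'
  rw [ker_wedgeForm, inf_bot_eq, finrank_bot] at horth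
  have hle : A' ≤ (wedgeForm b).orthogonal A' := fun x hx y hy => by
    change topForm b (y * x : ExteriorAlgebra k V) = 0
    rw [show (y * x : ExteriorAlgebra k V) = 0 from hiso _ hy _ hx, map_zero]
  have heq := Submodule.eq_of_le_of_finrank_eq hle (by lia)
  have hmem : (⟨w, hw⟩ : ⋀[k]^m V) ∈ A' := by
    rw [heq]
    exact fun a ha => h a ha
  exact hmem

/-- A linearly independent family of linear forms is part of the coordinates of a basis. -/
lemma exists_basis_coord_eq [FiniteDimensional k V] {m n : ℕ} (hdim : finrank k V = m + n)
    {φ : Fin m → Dual k V} (hφ : LinearIndependent k φ) :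
    ∃ b : Basis (Fin m ⊕ Fin n) k V, ∀ i, b.coord (Sum.inl i) = φ i := by
  classical
  have : Fintype (Fin m ⊕ Basis.sumExtendIndex hφ) :=
    FiniteDimensional.fintypeBasisIndex (Basis.sumExtend hφ)
  have : Fintype (Basis.sumExtendIndex hφ) :=
    Fintype.ofInjective (Sum.inr : _ → Fin m ⊕ Basis.sumExtendIndex hφ) Sum.inr_injective
  have hcard : Fintype.card (Basis.sumExtendIndex hφ) = n := by
    have := finrank_eq_card_basis (Basis.sumExtend hφ)
    rw [Subspace.dual_finrank_eq, hdim, ← Nat.card_eq_fintype_card, Nat.card_sum,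
      Nat.card_eq_fintype_card, Nat.card_eq_fintype_card, Fintype.card_fin] at this
    lia
  let c : Basis (Fin m ⊕ Fin n) k (Dual k V) :=
    (Basis.sumExtend hφ).reindex ((Equiv.refl _).sumCongr (Fintype.equivFinOfCardEq hcard))
  let b : Basis (Fin m ⊕ Fin n) k V := c.dualBasis.map (evalEquiv k V).symm
  have hcb (i j) : c i (b j) = if i = j then 1 else 0 := by
    have h : evalEquiv k V (b j) = c.dualBasis j := (evalEquiv k V).apply_symm_apply _
    rw [← Dual.eval_apply, ← evalEquiv_toLinearMap, LinearEquiv.coe_coe, h,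
      Basis.dualBasis_apply_self]
  refine ⟨b, fun i => ?_⟩
  have hci : c (Sum.inl i) = φ i := by
    simp [c, Basis.sumExtend]
    rfl
  refine b.ext fun j => ?_
  rw [← hci, hcb, Basis.coord_apply, Basis.repr_self, Finsupp.single_apply]
  simp [eq_comm]

/-- Wedging with the remaining basis vectors computes the minors of the first coordinates. -/
lemma topForm_mul_ιMulti {m n : ℕ} (b : Basis (Fin m ⊕ Fin n) k V) (v : Fin m → V) :
    topForm (b.reindex finSumFinEquiv) (ιMulti k m v * ιMulti k n (b ∘ Sum.inr)) =
      Matrix.det (Matrix.of fun i j => b.coord (Sum.inl i) (v j)) := by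
  rw [ιMulti_mul_ιMulti, topForm_ιMulti, Basis.det_reindex, Basis.det_apply]
  have : b.toMatrix (Fin.append v (b ∘ Sum.inr) ∘ finSumFinEquiv) =
      Matrix.fromBlocks (Matrix.of fun i j => b.coord (Sum.inl i) (v j)) 0
        (Matrix.of fun i j => b.coord (Sum.inr i) (v j)) 1 := by
    ext (i | i) (j | j) <;> simp [Basis.toMatrix_apply, Finsupp.single_apply, Matrix.one_apply,
      eq_comm]
  rw [this, Matrix.det_fromBlocks_zero₁₂, Matrix.det_one, mul_one]

lemma ιMulti_three (v : Fin 3 → V) : ιMulti k 3 v = ι k (v 0) * ι k (v 1) * ι k (v 2) := by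
  simp [ιMulti_apply, mul_assoc]
  rfl

end Wedge

/-- If `A ⊆ ⋀³V` (with `dim V = 6`, `char k ≠ 2`) is a Lagrangian subspace containing no
nonzero decomposable vector, then its annihilator `A⊥ ⊆ ⋀³(V∨)` (with respect to the natural
pairing `B`, determined by `⟨φ₁∧φ₂∧φ₃, v₁∧v₂∧v₃⟩ = det(φᵢ(vⱼ))`) contains no nonzero
decomposable vector. -/
theorem annihilator_no_decomposable
    {k V : Type*} [Field k] [AddCommGroup V] [Module k V]
    (hchar : ringChar k ≠ 2) (hdimV : Module.finrank k V = 6)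
    (B : ExteriorAlgebra k (Module.Dual k V) →ₗ[k] ExteriorAlgebra k V →ₗ[k] k)
    (hB : ∀ (φ : Fin 3 → Module.Dual k V) (v : Fin 3 → V),
      B (ExteriorAlgebra.ι k (φ 0) * ExteriorAlgebra.ι k (φ 1) * ExteriorAlgebra.ι k (φ 2))
        (ExteriorAlgebra.ι k (v 0) * ExteriorAlgebra.ι k (v 1) * ExteriorAlgebra.ι k (v 2)) =
        Matrix.det (Matrix.of fun i j => φ i (v j)))
    (A : Submodule k (ExteriorAlgebra k V))
    (hA3 : A ≤ wedgePow (⊤ : Submodule k V) 3)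
    (hA10 : Module.finrank k A = 10)
    (hLag : ∀ a ∈ A, ∀ a' ∈ A, a * a' = 0)
    (hdec : ∀ v₁ v₂ v₃ : V,
      ExteriorAlgebra.ι k v₁ * ExteriorAlgebra.ι k v₂ * ExteriorAlgebra.ι k v₃ ∈ A →
      ExteriorAlgebra.ι k v₁ * ExteriorAlgebra.ι k v₂ * ExteriorAlgebra.ι k v₃ = 0) :
    ∀ ξ : ExteriorAlgebra k (Module.Dual k V),
      ξ ∈ wedgePow (⊤ : Submodule k (Module.Dual k V)) 3 →
      (∀ a ∈ A, B ξ a = 0) →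
      (∃ φ₁ φ₂ φ₃ : Module.Dual k V,
        ξ = ExteriorAlgebra.ι k φ₁ * ExteriorAlgebra.ι k φ₂ * ExteriorAlgebra.ι k φ₃) →
      ξ = 0 := by
  rintro ξ - hξ ⟨φ₁, φ₂, φ₃, rfl⟩
  set φ : Fin 3 → Module.Dual k V := ![φ₁, φ₂, φ₃]
  have hξφ : ExteriorAlgebra.ι k φ₁ * ExteriorAlgebra.ι k φ₂ * ExteriorAlgebra.ι k φ₃ =
      ExteriorAlgebra.ιMulti k 3 φ := by
    rw [ιMulti_three]
    rfl
  rw [hξφ] at hξ ⊢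
  by_contra hne
  have : FiniteDimensional k V := .of_finrank_pos (by lia)
  have hφ : LinearIndependent k φ := by
    by_contra hdep
    exact hne ((ExteriorAlgebra.ιMulti k 3).map_linearDependent φ hdep)
  obtain ⟨b, hb⟩ := exists_basis_coord_eq (m := 3) (n := 3) hdimV hφ
  have hpow : wedgePow (⊤ : Submodule k V) 3 = ⋀[k]^3 V := by
    rw [wedgePow, Submodule.map_top]
  rw [hpow] at hA3
  let D := topForm (b.reindex finSumFinEquiv)
  let w := ExteriorAlgebra.ιMulti k 3 (b ∘ Sum.inr)
  have hBD : ∀ a ∈ ⋀[k]^3 V, D (a * w) = B (ExteriorAlgebra.ιMulti k 3 φ) a := by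
    intro a ha
    rw [← ExteriorAlgebra.ιMulti_span_fixedDegree] at ha
    induction ha using Submodule.span_induction with
    | mem a ha =>
      obtain ⟨v, rfl⟩ := ha
      rw [topForm_mul_ιMulti, ιMulti_three φ, ιMulti_three v, hB]
      simp only [hb]
    | zero => simp
    | add x y _ _ hx hy => rw [add_mul, map_add, map_add, hx, hy]
    | smul c x _ hx => rw [smul_mul_assoc, map_smul, map_smul, hx]
  have hwA : w ∈ A := by
    refine mem_of_isotropic (b.reindex finSumFinEquiv) hA3 ?_ hLag
      (ExteriorAlgebra.ιMulti_range k 3 ⟨_, rfl⟩) fun a ha => (hBD a (hA3 ha)).trans (hξ a ha)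
    rw [hA10, exteriorPower.finrank_eq, hdimV]
    rfl
  have hw0 : w = 0 := by
    rw [show w = _ from ιMulti_three _] at hwA ⊢
    exact hdec _ _ _ hwA
  have hD := topForm_mul_ιMulti b (b ∘ Sum.inl)
  rw [show ExteriorAlgebra.ιMulti k 3 (b ∘ Sum.inr) = 0 from hw0, mul_zero, map_zero] at hD
  have hone : (Matrix.of fun i j => b.coord (Sum.inl i) ((b ∘ Sum.inl) j)) =
      (1 : Matrix (Fin 3) (Fin 3) k) := by
    ext i j
    simp [Finsupp.single_apply, Matrix.one_apply, eq_comm]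
  rw [hone, Matrix.det_one] at hD
  exact zero_ne_one hD
end
end

section
/- Let k be a field and V a 6-dimensional k-vector space. If A ⊆ ⋀³V is a Lagrangian subspace (dim A = 10 and a∧a′ = 0 in ⋀⁶V for all a, a′ ∈ A), then its annihilator A⊥ ⊆ ⋀³(V∨) is a Lagrangian subspace of ⋀³(V∨): dim A⊥ = 10 and ξ∧ξ′ = 0 in ⋀⁶(V∨) for all ξ, ξ′ ∈ A⊥. -/
noncomputable section

open Module Matrix Set.powersetCard

/-- The bilinear form `(x, y) ↦ x ⬝ᵥ y` on `ι → k`. -/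
def dotForm (k ι : Type*) [Field k] [Fintype ι] : LinearMap.BilinForm k (ι → k) :=
  dotProductBilin k k

theorem dotForm_apply {k ι : Type*} [Field k] [Fintype ι] (x y : ι → k) :
    dotForm k ι x y = x ⬝ᵥ y := rfl

theorem finrank_dotForm_orthogonal {k ι : Type*} [Field k] [Fintype ι]
    (A : Submodule k (ι → k)) :
    finrank k ((dotForm k ι).orthogonal A) = Fintype.card ι - finrank k A := by
  rw [LinearMap.BilinForm.finrank_orthogonal, finrank_fintype_fun_eq_card]
  refine ⟨fun x hx => dotProduct_eq_zero x hx, fun x hx => dotProduct_eq_zero x fun y => ?_⟩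
  rw [dotProduct_comm]
  exact hx y

/-- The orthogonal complement of a maximal isotropic subspace for an orthogonal matrix `W` is
again isotropic for `W`. -/
theorem dotProduct_mulVec_eq_zero_of_mem_orthogonal {k ι : Type*} [Field k] [Fintype ι]
    [DecidableEq ι] {W : Matrix ι ι k} (hW : W * Wᵀ = 1) {A : Submodule k (ι → k)}
    (hA : 2 * finrank k A = Fintype.card ι)
    (hiso : ∀ a ∈ A, ∀ a' ∈ A, a ⬝ᵥ W *ᵥ a' = 0) {x y : ι → k}
    (hx : x ∈ (dotForm k ι).orthogonal A) (hy : y ∈ (dotForm k ι).orthogonal A) :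
    x ⬝ᵥ W *ᵥ y = 0 := by
  have hinj : Function.Injective (vecMulLinear W) := fun a b h => by
    have h' : a ᵥ* W ᵥ* Wᵀ = b ᵥ* W ᵥ* Wᵀ := congrArg (· ᵥ* Wᵀ) h
    simpa [vecMul_vecMul, hW] using h'
  have hrank : finrank k (A.map (vecMulLinear W)) = finrank k A :=
    (Submodule.equivMapOfInjective _ hinj A).finrank_eq.symm
  have hle : A.map (vecMulLinear W) ≤ (dotForm k ι).orthogonal A := by
    rintro _ ⟨a, ha, rfl⟩ b hb
    change b ⬝ᵥ a ᵥ* W = 0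
    rw [dotProduct_comm, ← dotProduct_mulVec]
    exact hiso a ha b hb
  have heq : A.map (vecMulLinear W) = (dotForm k ι).orthogonal A := by
    apply Submodule.eq_of_le_of_finrank_eq hle
    rw [hrank, finrank_dotForm_orthogonal]
    omega
  rw [← heq] at hx hy
  obtain ⟨a, ha, rfl⟩ := hx
  obtain ⟨b, hb, rfl⟩ := hy
  change a ᵥ* W ⬝ᵥ W *ᵥ (b ᵥ* W) = 0
  rw [← mulVec_transpose W b, mulVec_mulVec, hW, one_mulVec, ← dotProduct_mulVec]
  exact hiso a ha b hb

/-- The matrix of the wedge product `⋀ⁿ × ⋀ⁿ → ⋀²ⁿ` with respect to the bases induced by a basis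
indexed by `I`, when `I` has `2n` elements. -/
def wedgeMatrix (k I : Type*) [Field k] [LinearOrder I] (n : ℕ) :
    Matrix (Set.powersetCard I n) (Set.powersetCard I n) k :=
  .of fun s t => if h : Disjoint s.val t.val then
    (((permOfDisjoint h).sign : ℤ) : k) else 0

theorem wedgeMatrix_mul_transpose {k I : Type*} [Field k] [LinearOrder I] [Fintype I] {n : ℕ}
    (hI : Fintype.card I = n + n) :
    wedgeMatrix k I n * (wedgeMatrix k I n)ᵀ = 1 := by
  have hcompl : ∀ s t : Set.powersetCard I n, Disjoint s.val t.val → t.val = s.valᶜ := by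
    intro s t h
    apply Finset.eq_of_subset_of_card_le
    · exact fun i hi => Finset.mem_compl.2 fun hi' => Finset.disjoint_left.1 h hi' hi
    · rw [Finset.card_compl, hI, s.prop, t.prop]
      omega
  ext s s'
  rw [mul_apply, one_apply]
  split_ifs with hs
  · subst hs
    let t : Set.powersetCard I n := ⟨s.valᶜ, by
      have := s.prop
      simp only [Set.powersetCard, Set.mem_ofPred_eq] at this ⊢
      rw [Finset.card_compl, hI, this]
      omega⟩
    rw [Finset.sum_eq_single t]
    · have ht : Disjoint s.val t.val := disjoint_compl_right
      simp only [wedgeMatrix, transpose_apply, of_apply, dif_pos ht]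
      rw [← Int.cast_mul, Int.units_coe_mul_self, Int.cast_one]
    · intro u _ hu
      have : ¬ Disjoint s.val u.val := fun h => hu (Subtype.ext (hcompl s u h))
      simp [wedgeMatrix, this]
    · simp
  · refine Finset.sum_eq_zero fun t _ => ?_
    by_cases h : Disjoint s.val t.val
    · by_cases h' : Disjoint s'.val t.val
      · exact absurd (Subtype.ext (compl_injective
          ((hcompl s t h).symm.trans (hcompl s' t h')))) hs
      · simp [wedgeMatrix, h']
    · simp [wedgeMatrix, h]

/-- The coordinates on `⋀ⁿV` given by a basis of `V`, as a parametrisation of `⋀ⁿV` inside the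
exterior algebra. -/
def wedgeCoord {k V I : Type*} [Field k] [AddCommGroup V] [Module k V] [LinearOrder I]
    [Fintype I] (b : Basis I k V) (n : ℕ) :
    (Set.powersetCard I n → k) →ₗ[k] ExteriorAlgebra k V :=
  Fintype.linearCombination k (ExteriorAlgebra.ιMulti_family k n b)

theorem linearIndependent_ιMulti_family {k V I : Type*} [Field k] [AddCommGroup V]
    [Module k V] [LinearOrder I] (b : Basis I k V) (n : ℕ) :
    LinearIndependent k (ExteriorAlgebra.ιMulti_family k n b) := by
  rw [exteriorPower.ιMulti_family_eq_coe_comp]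
  exact (exteriorPower.ιMulti_family_linearIndependent_ofBasis k n b).map' (⋀[k]^n V).subtype
    (Submodule.ker_subtype _)

theorem wedgeCoord_injective {k V I : Type*} [Field k] [AddCommGroup V] [Module k V]
    [LinearOrder I] [Fintype I] (b : Basis I k V) (n : ℕ) :
    Function.Injective (wedgeCoord b n) :=
  linearIndependent_iff_injective_fintypeLinearCombination.1
    (linearIndependent_ιMulti_family b n)

theorem range_wedgeCoord {k V I : Type*} [Field k] [AddCommGroup V] [Module k V]
    [LinearOrder I] [Fintype I] (b : Basis I k V) (n : ℕ) :
    LinearMap.range (wedgeCoord b n) = wedgePow (⊤ : Submodule k V) n := by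
  rw [wedgeCoord, Fintype.range_linearCombination,
    exteriorPower.ιMulti_family_span_fixedDegree_of_span k b.span_eq, wedgePow, Submodule.map_top]

theorem wedgeCoord_mul {k V I : Type*} [Field k] [AddCommGroup V] [Module k V] [LinearOrder I]
    [Fintype I] (b : Basis I k V) {n : ℕ} (hI : Fintype.card I = n + n)
    (u : Set.powersetCard I (n + n)) (x y : Set.powersetCard I n → k) :
    wedgeCoord b n x * wedgeCoord b n y =
      (x ⬝ᵥ wedgeMatrix k I n *ᵥ y) • ExteriorAlgebra.ιMulti_family k (n + n) b u := by
  have hu : ∀ u' : Set.powersetCard I (n + n), u' = u := by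
    have huniv : ∀ w : Set.powersetCard I (n + n), w.val = Finset.univ := fun w =>
      Finset.eq_univ_of_card _ (w.prop.trans hI.symm)
    exact fun u' => Subtype.ext ((huniv u').trans (huniv u).symm)
  have hmul : ∀ s t : Set.powersetCard I n,
      ExteriorAlgebra.ιMulti_family k n b s * ExteriorAlgebra.ιMulti_family k n b t =
        wedgeMatrix k I n s t • ExteriorAlgebra.ιMulti_family k (n + n) b u := by
    intro s t
    by_cases h : Disjoint s.val t.val
    · rw [ExteriorAlgebra.ιMulti_family_mul_of_disjoint k b s t h, hu (disjUnion h)]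
      simp only [wedgeMatrix, of_apply, dif_pos h]
      rw [Int.cast_smul_eq_zsmul, Units.smul_def]
    · rw [ExteriorAlgebra.ιMulti_family_mul_of_not_disjoint k b s t h]
      simp [wedgeMatrix, h]
  rw [wedgeCoord, Fintype.linearCombination_apply, Fintype.linearCombination_apply,
    Finset.sum_mul_sum]
  simp only [smul_mul_smul_comm, hmul, dotProduct, mulVec, Finset.mul_sum, Finset.sum_smul,
    smul_smul]
  refine Finset.sum_congr rfl fun s _ => Finset.sum_congr rfl fun t _ => ?_
  congr 1
  ring

theorem wedgeCoord_mul_eq_zero_iff {k V I : Type*} [Field k] [AddCommGroup V] [Module k V]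
    [LinearOrder I] [Fintype I] (b : Basis I k V) {n : ℕ} (hI : Fintype.card I = n + n)
    (x y : Set.powersetCard I n → k) :
    wedgeCoord b n x * wedgeCoord b n y = 0 ↔ x ⬝ᵥ wedgeMatrix k I n *ᵥ y = 0 := by
  rw [wedgeCoord_mul b hI ⟨Finset.univ, hI⟩, smul_eq_zero,
    or_iff_left ((linearIndependent_ιMulti_family b (n + n)).ne_zero _)]

/-- A pairing given by determinants on decomposable elements becomes the dot product in dual
coordinates. -/
theorem pairing_wedgeCoord {k V I : Type*} [Field k] [AddCommGroup V] [Module k V]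
    [LinearOrder I] [Fintype I] (b : Basis I k V) {n : ℕ}
    (B : ExteriorAlgebra k (Dual k V) →ₗ[k] ExteriorAlgebra k V →ₗ[k] k)
    (hB : ∀ (φ : Fin n → Dual k V) (v : Fin n → V),
      B (ExteriorAlgebra.ιMulti k n φ) (ExteriorAlgebra.ιMulti k n v) =
        det (of fun i j => φ i (v j)))
    (x y : Set.powersetCard I n → k) :
    B (wedgeCoord b.dualBasis n x) (wedgeCoord b n y) = x ⬝ᵥ y := by
  have hdual : ∀ s t : Set.powersetCard I n,
      B (ExteriorAlgebra.ιMulti_family k n b.dualBasis s) (ExteriorAlgebra.ιMulti_family k n b t) =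
        if s = t then 1 else 0 := by
    intro s t
    have h : B (ExteriorAlgebra.ιMulti_family k n b.dualBasis s)
        (ExteriorAlgebra.ιMulti_family k n b t) =
          exteriorPower.ιMultiDual k n b s (exteriorPower.ιMulti_family k n b t) := by
      rw [hB, exteriorPower.ιMulti_family, exteriorPower.ιMultiDual_apply_ιMulti,
        ← det_transpose]
      simp [transpose]
    rw [h]
    split_ifs with hst
    · rw [hst, exteriorPower.ιMultiDual_apply_diag]
    · exact exteriorPower.ιMultiDual_apply_nondiag k n b s t hst
  simp only [wedgeCoord, Fintype.linearCombination_apply, map_sum, map_smul,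
    LinearMap.sum_apply, LinearMap.smul_apply, hdual]
  simp [dotProduct, mul_comm]

/-- If `A ⊆ ⋀³V` (with `dim V = 6`) is a Lagrangian subspace, then its annihilator
`A⊥ ⊆ ⋀³(V∨)` (with respect to the natural pairing `B`, determined by
`⟨φ₁∧φ₂∧φ₃, v₁∧v₂∧v₃⟩ = det(φᵢ(vⱼ))`) is a Lagrangian subspace of `⋀³(V∨)`:
it has dimension `10` and `ξ∧ξ′ = 0` for all `ξ, ξ′ ∈ A⊥`. -/
theorem annihilator_lagrangian
    {k V : Type*} [Field k] [AddCommGroup V] [Module k V]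
    (hdimV : Module.finrank k V = 6)
    (B : ExteriorAlgebra k (Module.Dual k V) →ₗ[k] ExteriorAlgebra k V →ₗ[k] k)
    (hB : ∀ (φ : Fin 3 → Module.Dual k V) (v : Fin 3 → V),
      B (ExteriorAlgebra.ι k (φ 0) * ExteriorAlgebra.ι k (φ 1) * ExteriorAlgebra.ι k (φ 2))
        (ExteriorAlgebra.ι k (v 0) * ExteriorAlgebra.ι k (v 1) * ExteriorAlgebra.ι k (v 2)) =
        Matrix.det (Matrix.of fun i j => φ i (v j)))
    (A : Submodule k (ExteriorAlgebra k V))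
    (hA3 : A ≤ wedgePow (⊤ : Submodule k V) 3)
    (hA10 : Module.finrank k A = 10)
    (hLag : ∀ a ∈ A, ∀ a' ∈ A, a * a' = 0) :
    ∀ Aperp : Submodule k (ExteriorAlgebra k (Module.Dual k V)),
      (Aperp : Set (ExteriorAlgebra k (Module.Dual k V))) =
        {ξ | ξ ∈ wedgePow (⊤ : Submodule k (Module.Dual k V)) 3 ∧ ∀ a ∈ A, B ξ a = 0} →
      Module.finrank k Aperp = 10 ∧ ∀ ξ ∈ Aperp, ∀ ξ' ∈ Aperp, ξ * ξ' = 0 := by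
  intro Aperp hAperp
  have : FiniteDimensional k V := .of_finrank_pos (by omega)
  let b : Basis (Fin 6) k V := finBasisOfFinrankEq k V hdimV
  have hI : Fintype.card (Fin 6) = 3 + 3 := rfl
  have hcard : Fintype.card (Set.powersetCard (Fin 6) 3) = 20 := by
    rw [Fintype.card_eq_nat_card, Set.powersetCard.card, Nat.card_eq_fintype_card]
    rfl
  have hpair := pairing_wedgeCoord (n := 3) b B fun φ v => by
    simpa [ExteriorAlgebra.ιMulti_apply, List.ofFn_succ, vecTail, mul_assoc] using hB φ v
  let A₀ := A.comap (wedgeCoord b 3)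
  have hA : A₀.map (wedgeCoord b 3) = A :=
    Submodule.map_comap_eq_of_le (hA3.trans (range_wedgeCoord b 3).ge)
  have hA₀ : finrank k A₀ = 10 := by
    rw [← hA10, ← hA]
    exact (Submodule.equivMapOfInjective _ (wedgeCoord_injective b 3) A₀).finrank_eq
  have hperp : Aperp = ((dotForm k _).orthogonal A₀).map (wedgeCoord b.dualBasis 3) := by
    ext ξ
    rw [← SetLike.mem_coe, hAperp, Set.mem_ofPred_eq, ← range_wedgeCoord b.dualBasis]
    constructor
    · rintro ⟨⟨x, rfl⟩, hx⟩
      refine ⟨x, fun a ha => ?_, rfl⟩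
      change a ⬝ᵥ x = 0
      rw [dotProduct_comm, ← hpair]
      exact hx _ ha
    · rintro ⟨x, hx, rfl⟩
      refine ⟨⟨x, rfl⟩, fun a ha => ?_⟩
      rw [← hA] at ha
      obtain ⟨a, ha, rfl⟩ := ha
      rw [hpair, dotProduct_comm]
      exact hx a ha
  subst hperp
  constructor
  · rw [← (Submodule.equivMapOfInjective _ (wedgeCoord_injective b.dualBasis 3) _).finrank_eq,
      finrank_dotForm_orthogonal, hcard, hA₀]
  · rintro _ ⟨x, hx, rfl⟩ _ ⟨y, hy, rfl⟩
    rw [wedgeCoord_mul_eq_zero_iff b.dualBasis hI]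
    refine dotProduct_mulVec_eq_zero_of_mem_orthogonal (wedgeMatrix_mul_transpose hI)
      (by rw [hA₀, hcard]) (fun a ha a' ha' => ?_) hx hy
    rw [← wedgeCoord_mul_eq_zero_iff b hI]
    exact hLag _ ha _ ha'
end
end

section
/- Let k be a field, V a 6-dimensional k-vector space, A ⊆ ⋀³V a subspace with dim A = 10, u ∈ V∨ a nonzero linear form, and U = ker(u). Then the following three conditions are equivalent: (i) A ∩ ⋀³U = 0; (ii) A⊥ + F_u = ⋀³(V∨); (iii) A⊥ ∩ F_u = 0. Here A⊥ ⊆ ⋀³(V∨) is the annihilator of A and F_u = {ξ ∈ ⋀³(V∨) : u∧ξ = 0}. -/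
noncomputable section

/-- The exterior power of a space is its top `wedgePow`. -/
theorem wedgePow_top {k V : Type*} [Field k] [AddCommGroup V] [Module k V] (n : ℕ) :
    wedgePow (⊤ : Submodule k V) n = ⋀[k]^n V := by
  rw [wedgePow, Submodule.map_top]

theorem exteriorPower.coe_map {R M N : Type*} [CommRing R] [AddCommGroup M] [Module R M]
    [AddCommGroup N] [Module R N] {n : ℕ} (f : M →ₗ[R] N) (x : ⋀[R]^n M) :
    (exteriorPower.map n f x : ExteriorAlgebra R N) = ExteriorAlgebra.map f x := by
  have h : (⋀[R]^n N).subtype ∘ₗ exteriorPower.map n f =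
      (ExteriorAlgebra.map f).toLinearMap ∘ₗ (⋀[R]^n M).subtype := by
    apply exteriorPower.linearMap_ext
    ext v
    simp
  exact LinearMap.congr_fun h x

theorem wedgePow_eq_map_range {k V : Type*} [Field k] [AddCommGroup V] [Module k V]
    (U : Submodule k V) (n : ℕ) :
    wedgePow U n = (LinearMap.range (exteriorPower.map n U.subtype)).map (⋀[k]^n V).subtype := by
  have h : (⋀[k]^n V).subtype ∘ₗ exteriorPower.map n U.subtype =
      (ExteriorAlgebra.map U.subtype).toLinearMap ∘ₗ (⋀[k]^n U).subtype := by
    ext1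
    ext v
    simp
  rw [← LinearMap.range_comp, h, LinearMap.range_comp, Submodule.range_subtype,
    Submodule.map_pow, ExteriorAlgebra.ι_range_map_map, Submodule.range_subtype, wedgePow]

theorem exteriorPower.pairingDual_bijective {K E : Type*} [Field K] [AddCommGroup E] [Module K E]
    [FiniteDimensional K E] (n : ℕ) : Function.Bijective (exteriorPower.pairingDual K E n) := by
  have hsurj : Function.Surjective (exteriorPower.pairingDual K E n) := by
    let b := Module.finBasis K E
    rw [← LinearMap.range_eq_top, eq_top_iff, ← (b.exteriorPower n).dualBasis.span_eq,
      Submodule.span_le]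
    rintro - ⟨s, rfl⟩
    rw [Module.Basis.coe_dualBasis, exteriorPower.basis_coord]
    exact LinearMap.mem_range_self _ _
  have hdim : Module.finrank K (⋀[K]^n (Module.Dual K E)) =
      Module.finrank K (Module.Dual K (⋀[K]^n E)) := by
    rw [Subspace.dual_finrank_eq, exteriorPower.finrank_eq, exteriorPower.finrank_eq,
      Subspace.dual_finrank_eq]
  exact ⟨(LinearMap.injective_iff_surjective_of_finrank_eq_finrank hdim).2 hsurj, hsurj⟩

theorem exteriorPower.pairingDual_map_dualMap {R M N : Type*} [CommRing R] [AddCommGroup M]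
    [Module R M] [AddCommGroup N] [Module R N] {n : ℕ} (f : M →ₗ[R] N)
    (ξ : ⋀[R]^n (Module.Dual R N)) (w : ⋀[R]^n M) :
    exteriorPower.pairingDual R M n (exteriorPower.map n f.dualMap ξ) w =
      exteriorPower.pairingDual R N n ξ (exteriorPower.map n f w) := by
  have h : exteriorPower.pairingDual R M n ∘ₗ exteriorPower.map n f.dualMap =
      (exteriorPower.map n f).dualMap ∘ₗ exteriorPower.pairingDual R N n := by
    ext φ v
    simp
  exact LinearMap.congr_fun (LinearMap.congr_fun h ξ) w

theorem ExteriorAlgebra.ιMulti_three {R M : Type*} [CommRing R] [AddCommGroup M] [Module R M]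
    (v : Fin 3 → M) :
    ExteriorAlgebra.ιMulti R 3 v =
      ExteriorAlgebra.ι R (v 0) * ExteriorAlgebra.ι R (v 1) * ExteriorAlgebra.ι R (v 2) := by
  simp [ExteriorAlgebra.ιMulti_apply, List.ofFn_succ, mul_assoc, -ExteriorAlgebra.ιMulti_succ_apply]

theorem Submodule.map_eq_bot_iff_of_inj {R M N : Type*} [Ring R] [AddCommGroup M]
    [Module R M] [AddCommGroup N] [Module R N] {f : M →ₗ[R] N} (hf : Function.Injective f)
    {p : Submodule R M} : p.map f = ⊥ ↔ p = ⊥ := by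
  rw [← Submodule.map_bot f, (Submodule.map_injective_of_injective hf).eq_iff]

/-- Left multiplication by `u` only depends on the class modulo `u`. -/
theorem ExteriorAlgebra.ι_mul_map_sub_smul {R M : Type*} [CommRing R] [AddCommGroup M]
    [Module R M] (u : M) (p : M →ₗ[R] M) (c : M → R) (hp : ∀ m, p m = m - c m • u)
    (x : ExteriorAlgebra R M) :
    ExteriorAlgebra.ι R u * ExteriorAlgebra.map p x = ExteriorAlgebra.ι R u * x := by
  have swap (a b : M) (y : ExteriorAlgebra R M) :
      ExteriorAlgebra.ι R a * (ExteriorAlgebra.ι R b * y) =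
        -(ExteriorAlgebra.ι R b * (ExteriorAlgebra.ι R a * y)) := by
    rw [← mul_assoc, ← mul_assoc, ← neg_mul,
      eq_neg_of_add_eq_zero_left (ExteriorAlgebra.ι_add_mul_swap a b)]
  induction x using CliffordAlgebra.left_induction with
  | algebraMap r => simp
  | add x y hx hy => simp only [map_add, mul_add, hx, hy]
  | ι_mul x m hx =>
    change ExteriorAlgebra.ι R u * ExteriorAlgebra.map p (ExteriorAlgebra.ι R m * x) =
      ExteriorAlgebra.ι R u * (ExteriorAlgebra.ι R m * x)
    rw [map_mul, ExteriorAlgebra.map_apply_ι, swap, hx, swap u m, hp, map_sub, map_smul, sub_mul,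
      smul_mul_assoc, ← mul_assoc (ExteriorAlgebra.ι R u), ExteriorAlgebra.ι_sq_zero, zero_mul,
      smul_zero, sub_zero]

/-- If `d u = 1` and `u ∧ x = 0`, then `x` is a multiple of `u`. -/
theorem ExteriorAlgebra.exists_eq_ι_mul_of_ι_mul_eq_zero {R M : Type*} [CommRing R]
    [AddCommGroup M] [Module R M] {u : M} {d : Module.Dual R M} (hd : d u = 1)
    {x : ExteriorAlgebra R M} (hx : ExteriorAlgebra.ι R u * x = 0) :
    ∃ y, x = ExteriorAlgebra.ι R u * y := by
  refine ⟨CliffordAlgebra.contractLeft d x, ?_⟩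
  have h := CliffordAlgebra.contractLeft_ι_mul (Q := (0 : QuadraticForm R M)) (d := d) u x
  change CliffordAlgebra.contractLeft d (ExteriorAlgebra.ι R u * x) =
    d u • x - ExteriorAlgebra.ι R u * CliffordAlgebra.contractLeft d x at h
  rw [hx, map_zero, hd, one_smul] at h
  exact sub_eq_zero.1 h.symm

/-- The elements of `⋀ⁿ(V∨)` killed by `u` are those which annihilate `⋀ⁿ(ker u)`. -/
theorem exteriorPower.ι_mul_eq_zero_iff {K E : Type*} [Field K] [AddCommGroup E] [Module K E]
    [FiniteDimensional K E] {n : ℕ} {u : Module.Dual K E} (hu : u ≠ 0)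
    (ξ : ⋀[K]^n (Module.Dual K E)) :
    ExteriorAlgebra.ι K u * (ξ : ExteriorAlgebra K (Module.Dual K E)) = 0 ↔
      exteriorPower.pairingDual K E n ξ ∈
        (LinearMap.range (exteriorPower.map n (LinearMap.ker u).subtype)).dualAnnihilator := by
  obtain ⟨e, he⟩ : ∃ e, u e = 1 := by
    obtain ⟨x, hx⟩ := DFunLike.ne_iff.1 hu
    exact ⟨(u x)⁻¹ • x, by simpa using inv_mul_cancel₀ hx⟩
  let q : E →ₗ[K] LinearMap.ker u :=
    (LinearMap.id - u.smulRight e).codRestrict _ fun v => by simp [he]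
  let r : E →ₗ[K] E := (LinearMap.ker u).subtype ∘ₗ q
  have hr (v : E) : r v = v - u v • e := rfl
  have hrdual (φ : Module.Dual K E) : r.dualMap φ = φ - φ e • u := by
    ext v
    simp [hr, mul_comm]
  have hrcomp : r ∘ₗ (LinearMap.ker u).subtype = (LinearMap.ker u).subtype := by
    ext ⟨v, hv⟩
    simp [hr, LinearMap.mem_ker.1 hv]
  have hzero : ExteriorAlgebra.ι K u * (ξ : ExteriorAlgebra K (Module.Dual K E)) = 0 ↔
      exteriorPower.map n r.dualMap ξ = 0 := by
    constructor
    · intro h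
      obtain ⟨y, hy⟩ := ExteriorAlgebra.exists_eq_ι_mul_of_ι_mul_eq_zero
        (d := Module.Dual.eval K E e) (by simpa using he) h
      apply Subtype.ext
      rw [exteriorPower.coe_map, hy, map_mul, ExteriorAlgebra.map_apply_ι, hrdual, he]
      simp
    · intro h
      rw [← ExteriorAlgebra.ι_mul_map_sub_smul u r.dualMap (fun φ => φ e) hrdual,
        ← exteriorPower.coe_map, h]
      simp
  rw [hzero, Submodule.mem_dualAnnihilator]
  constructor
  · rintro h - ⟨w, rfl⟩
    rw [← hrcomp, exteriorPower.map_comp, LinearMap.comp_apply,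
      ← exteriorPower.pairingDual_map_dualMap, h]
    simp
  · intro h
    apply (exteriorPower.pairingDual_bijective n).1
    rw [map_zero]
    apply LinearMap.ext
    intro w
    rw [exteriorPower.pairingDual_map_dualMap, exteriorPower.map_comp]
    exact h _ ⟨_, rfl⟩

/-- Two subspaces of complementary dimension are independent iff their annihilators span the dual,
iff their annihilators are independent. -/
theorem Subspace.disjoint_iff_dualAnnihilator {K W : Type*} [Field K] [AddCommGroup W]
    [Module K W] [FiniteDimensional K W] (A C : Submodule K W)
    (hdim : Module.finrank K W = Module.finrank K A + Module.finrank K C) :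
    (A ⊓ C = ⊥ ↔ A.dualAnnihilator ⊔ C.dualAnnihilator = ⊤) ∧
      (A ⊓ C = ⊥ ↔ A.dualAnnihilator ⊓ C.dualAnnihilator = ⊥) := by
  constructor
  · rw [← Subspace.dualAnnihilator_inf_eq, ← Submodule.dualAnnihilator_bot,
      Subspace.dualAnnihilator_inj]
  · rw [← Submodule.dualAnnihilator_sup_eq, Submodule.dualAnnihilator_eq_bot_iff,
      ← disjoint_iff, ← Submodule.isCompl_iff_disjoint A C hdim.le, ← codisjoint_iff]
    refine ⟨fun h => h.codisjoint, fun h => ?_⟩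
    rw [Submodule.isCompl_iff_disjoint A C hdim.le, disjoint_iff,
      ← Submodule.finrank_eq_zero (R := K)]
    have := Submodule.finrank_sup_add_finrank_inf_eq A C
    rw [codisjoint_iff.1 h, finrank_top] at this
    omega

/-- For a `10`-dimensional subspace `A ⊆ ⋀³V` (with `dim V = 6`), `0 ≠ u ∈ V∨` with kernel
`U`, the following are equivalent: (i) `A ∩ ⋀³U = 0`; (ii) `A⊥ + F_u = ⋀³(V∨)`;
(iii) `A⊥ ∩ F_u = 0`.  Here `A⊥` is the annihilator of `A` with respect to the natural
pairing `B` (determined by `⟨φ₁∧φ₂∧φ₃, v₁∧v₂∧v₃⟩ = det(φᵢ(vⱼ))`) and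
`F_u = {ξ ∈ ⋀³(V∨) : u∧ξ = 0}`. -/
theorem inf_wedge_eq_bot_iff
    {k V : Type*} [Field k] [AddCommGroup V] [Module k V]
    (hdimV : Module.finrank k V = 6)
    (B : ExteriorAlgebra k (Module.Dual k V) →ₗ[k] ExteriorAlgebra k V →ₗ[k] k)
    (hB : ∀ (φ : Fin 3 → Module.Dual k V) (v : Fin 3 → V),
      B (ExteriorAlgebra.ι k (φ 0) * ExteriorAlgebra.ι k (φ 1) * ExteriorAlgebra.ι k (φ 2))
        (ExteriorAlgebra.ι k (v 0) * ExteriorAlgebra.ι k (v 1) * ExteriorAlgebra.ι k (v 2)) =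
        Matrix.det (Matrix.of fun i j => φ i (v j)))
    (A : Submodule k (ExteriorAlgebra k V))
    (hA3 : A ≤ wedgePow (⊤ : Submodule k V) 3)
    (hA10 : Module.finrank k A = 10)
    (u : Module.Dual k V) (hu : u ≠ 0) :
    ∀ Aperp Fu : Submodule k (ExteriorAlgebra k (Module.Dual k V)),
      (Aperp : Set (ExteriorAlgebra k (Module.Dual k V))) =
        {ξ | ξ ∈ wedgePow (⊤ : Submodule k (Module.Dual k V)) 3 ∧ ∀ a ∈ A, B ξ a = 0} →
      (Fu : Set (ExteriorAlgebra k (Module.Dual k V))) =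
        {ξ | ξ ∈ wedgePow (⊤ : Submodule k (Module.Dual k V)) 3 ∧
          ExteriorAlgebra.ι k u * ξ = 0} →
      ((A ⊓ wedgePow (LinearMap.ker u) 3 = ⊥ ↔
          Aperp ⊔ Fu = wedgePow (⊤ : Submodule k (Module.Dual k V)) 3) ∧
       (A ⊓ wedgePow (LinearMap.ker u) 3 = ⊥ ↔ Aperp ⊓ Fu = ⊥)) := by
  intro Aperp Fu hAperp hFu
  have : FiniteDimensional k V := Module.finite_of_finrank_pos (by omega)
  let C := LinearMap.range (exteriorPower.map 3 (LinearMap.ker u).subtype)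
  let P := LinearEquiv.ofBijective _ (exteriorPower.pairingDual_bijective (K := k) (E := V) 3)
  rw [wedgePow_top] at hA3 hAperp hFu ⊢
  obtain ⟨A, rfl⟩ : ∃ A₀ : Submodule k (⋀[k]^3 V), A₀.map (⋀[k]^3 V).subtype = A :=
    ⟨A.comap (⋀[k]^3 V).subtype, by simpa using hA3⟩
  have hBP (ξ : ⋀[k]^3 (Module.Dual k V)) (w : ⋀[k]^3 V) : B ξ w = P ξ w := by
    have h : (B.domRestrict₁₂ (⋀[k]^3 (Module.Dual k V)) (⋀[k]^3 V)) =
        exteriorPower.pairingDual k V 3 := by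
      ext φ v
      simp only [LinearMap.compAlternatingMap_apply, LinearMap.domRestrict₁₂_apply,
        exteriorPower.ιMulti_apply_coe, exteriorPower.pairingDual_ιMulti_ιMulti]
      rw [← Matrix.det_transpose, ExteriorAlgebra.ιMulti_three, ExteriorAlgebra.ιMulti_three]
      exact hB φ v
    exact LinearMap.congr_fun (LinearMap.congr_fun h ξ) w
  have hmap (N : Submodule k (Module.Dual k (⋀[k]^3 V)))
      (F : Submodule k (ExteriorAlgebra k (Module.Dual k V)))
      (hle : F ≤ ⋀[k]^3 (Module.Dual k V))
      (h : ∀ ξ : ⋀[k]^3 (Module.Dual k V),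
        (ξ : ExteriorAlgebra k (Module.Dual k V)) ∈ F ↔ P ξ ∈ N) :
      F = N.map ((⋀[k]^3 (Module.Dual k V)).subtype ∘ₗ P.symm.toLinearMap) := by
    ext ξ
    constructor
    · intro hξ
      exact ⟨P ⟨ξ, hle hξ⟩, (h ⟨ξ, hle hξ⟩).1 hξ, by simp⟩
    · rintro ⟨η, hη, rfl⟩
      exact (h _).2 (by simpa using hη)
  have hinj : Function.Injective
      ((⋀[k]^3 (Module.Dual k V)).subtype ∘ₗ P.symm.toLinearMap) :=
    Subtype.val_injective.comp P.symm.injective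
  have hA : Aperp = _ := hmap A.dualAnnihilator Aperp
    (fun ξ hξ => ((Set.ext_iff.1 hAperp ξ).1 hξ).1) fun ξ => by
      rw [← SetLike.mem_coe, hAperp, Submodule.mem_dualAnnihilator]
      simp [← hBP]
  have hF : Fu = _ := hmap C.dualAnnihilator Fu
    (fun ξ hξ => ((Set.ext_iff.1 hFu ξ).1 hξ).1) fun ξ => by
      rw [← SetLike.mem_coe, hFu]
      exact (and_iff_right ξ.2).trans (exteriorPower.ι_mul_eq_zero_iff hu ξ)
  have htop : ⋀[k]^3 (Module.Dual k V) =
      (⊤ : Submodule k (Module.Dual k (⋀[k]^3 V))).map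
        ((⋀[k]^3 (Module.Dual k V)).subtype ∘ₗ P.symm.toLinearMap) :=
    hmap ⊤ _ le_rfl fun ξ => by simp
  have hker : Module.finrank k (LinearMap.ker u) = 5 := by
    have := Module.Dual.finrank_ker_add_one_of_ne_zero hu
    omega
  have hC : Module.finrank k C = 10 := by
    rw [LinearMap.finrank_range_of_inj
      (exteriorPower.map_injective_field (LinearMap.ker u).injective_subtype),
      exteriorPower.finrank_eq, hker]
    rfl
  have hW : Module.finrank k (⋀[k]^3 V) = 20 := by
    rw [exteriorPower.finrank_eq, hdimV]
    rfl
  rw [(Submodule.equivMapOfInjective _ (⋀[k]^3 V).injective_subtype A).finrank_eq.symm] at hA10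
  have key := Subspace.disjoint_iff_dualAnnihilator A C (by omega)
  have hinf : A.map (⋀[k]^3 V).subtype ⊓ wedgePow (LinearMap.ker u) 3 = ⊥ ↔ A ⊓ C = ⊥ := by
    rw [wedgePow_eq_map_range, ← Submodule.map_inf _ (⋀[k]^3 V).injective_subtype,
      Submodule.map_eq_bot_iff_of_inj (⋀[k]^3 V).injective_subtype]
  rw [hinf, htop, hA, hF, ← Submodule.map_sup, ← Submodule.map_inf _ hinj,
    (Submodule.map_injective_of_injective hinj).eq_iff,
    Submodule.map_eq_bot_iff_of_inj hinj]
  exact key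
end
end

section
/- Let k be a field with char(k) ≠ 2 and n ∈ {3,4,5}. Let V₆ be a 6-dimensional k-vector space, V₅ ⊂ V₆ a 5-dimensional subspace, W ⊆ ⋀²V₅ a subspace with dim W = n+5, ε : ⋀⁵V₅ → k a linear isomorphism, and q : V₆ → {bilinear forms on W} a linear map such that each q(v) is symmetric and such that q(v)(w, w′) = ε(v∧w∧w′) for all v ∈ V₅ and w, w′ ∈ W (note v∧w∧w′ ∈ ⋀⁵V₅). Fix v₀ ∈ V₆ ∖ V₅ and set A := {ξ + v₀∧w : ξ ∈ ⋀³V₅, w ∈ W, and ε(ξ∧w″) + q(v₀)(w, w″) = 0 for all w″ ∈ W} ⊆ ⋀³V₆. Then A is a linear subspace of ⋀³V₆ with dim A = 10, a∧a′ = 0 in ⋀⁶V₆ for all a, a′ ∈ A (so A is Lagrangian), and dim(A ∩ ⋀³V₅) = 5 − n. -/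
noncomputable section

section WedgePow

variable {k V : Type*} [Field k] [AddCommGroup V] [Module k V] {U : Submodule k V}

lemma exists_algebraMap_eq_of_mem_wedgePow_zero {x : ExteriorAlgebra k V} (hx : x ∈ wedgePow U 0) :
    ∃ c : k, algebraMap k (ExteriorAlgebra k V) c = x := by
  rwa [wedgePow, pow_zero, Submodule.mem_one] at hx

@[elab_as_elim]
lemma wedgePow_succ_induction {n : ℕ} {C : ExteriorAlgebra k V → Prop}
    {x : ExteriorAlgebra k V} (hx : x ∈ wedgePow U (n + 1))
    (hmul : ∀ u ∈ U, ∀ y ∈ wedgePow U n, C (ExteriorAlgebra.ι k u * y))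
    (hadd : ∀ x y, C x → C y → C (x + y)) : C x := by
  rw [wedgePow, pow_succ'] at hx
  refine Submodule.mul_induction_on hx ?_ hadd
  rintro _ ⟨u, hu, rfl⟩ y hy
  exact hmul u hu y hy

lemma mul_mem_wedgePow {m n : ℕ} {x y : ExteriorAlgebra k V} (hx : x ∈ wedgePow U m)
    (hy : y ∈ wedgePow U n) : x * y ∈ wedgePow U (m + n) := by
  rw [wedgePow, pow_add]
  exact Submodule.mul_mem_mul hx hy

lemma ι_mem_wedgePow_one {u : V} (hu : u ∈ U) : ExteriorAlgebra.ι k u ∈ wedgePow U 1 := by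
  rw [wedgePow, pow_one]
  exact Submodule.mem_map_of_mem hu

lemma ι_mul_mem_wedgePow {n : ℕ} {u : V} {y : ExteriorAlgebra k V} (hu : u ∈ U)
    (hy : y ∈ wedgePow U n) : ExteriorAlgebra.ι k u * y ∈ wedgePow U (n + 1) := by
  rw [add_comm]
  exact mul_mem_wedgePow (ι_mem_wedgePow_one hu) hy

lemma wedgePow_mono {U' : Submodule k V} (h : U ≤ U') (n : ℕ) : wedgePow U n ≤ wedgePow U' n :=
  pow_le_pow_left' (Submodule.map_mono h) n

lemma wedgePow_eq_map (U : Submodule k V) (n : ℕ) :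
    wedgePow U n =
      Submodule.map (ExteriorAlgebra.map U.subtype).toLinearMap (⋀[k]^n U) := by
  rw [Submodule.map_pow, ExteriorAlgebra.ι_range_map_map, Submodule.range_subtype,
    wedgePow]

lemma finrank_wedgePow [FiniteDimensional k U] (n : ℕ) :
    Module.finrank k (wedgePow U n) = (Module.finrank k U).choose n := by
  rw [wedgePow_eq_map, ← exteriorPower.finrank_eq]
  exact (Submodule.equivMapOfInjective (ExteriorAlgebra.map U.subtype).toLinearMap
    (ExteriorAlgebra.map_injective_field U.ker_subtype) _).finrank_eq.symm

instance [FiniteDimensional k U] (n : ℕ) : FiniteDimensional k (wedgePow U n) := by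
  rw [wedgePow_eq_map]
  infer_instance

lemma wedgePow_eq_bot [FiniteDimensional k U] {n : ℕ} (h : Module.finrank k U < n) :
    wedgePow U n = ⊥ := by
  rw [← Submodule.finrank_eq_zero (R := k), finrank_wedgePow, Nat.choose_eq_zero_of_lt h]

lemma ι_mul_ι_eq_neg (u v : V) :
    ExteriorAlgebra.ι k u * ExteriorAlgebra.ι k v =
      -(ExteriorAlgebra.ι k v * ExteriorAlgebra.ι k u) :=
  eq_neg_of_add_eq_zero_left (ExteriorAlgebra.ι_add_mul_swap u v)

lemma mul_ι_of_mem_wedgePow (v : V) (n : ℕ) {x : ExteriorAlgebra k V} (hx : x ∈ wedgePow U n) :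
    x * ExteriorAlgebra.ι k v = (-1) ^ n * (ExteriorAlgebra.ι k v * x) := by
  induction n generalizing x with
  | zero =>
    obtain ⟨c, rfl⟩ := exists_algebraMap_eq_of_mem_wedgePow_zero hx
    simp [Algebra.commutes]
  | succ n ih =>
    refine wedgePow_succ_induction hx (fun u _ y hy ↦ ?_) fun x y hx hy ↦ ?_
    · rw [mul_assoc, ih hy, ← mul_assoc (ExteriorAlgebra.ι k v), ι_mul_ι_eq_neg v u, pow_succ]
      rcases neg_one_pow_eq_or (ExteriorAlgebra k V) n with h | h <;> simp [h, mul_assoc]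
    · rw [add_mul, hx, hy, mul_add, mul_add]

lemma mul_comm_of_mem_wedgePow_two {n : ℕ} {w x : ExteriorAlgebra k V} (hw : w ∈ wedgePow U 2)
    (hx : x ∈ wedgePow U n) : w * x = x * w := by
  induction n generalizing x with
  | zero =>
    obtain ⟨c, rfl⟩ := exists_algebraMap_eq_of_mem_wedgePow_zero hx
    exact (Algebra.commutes c w).symm
  | succ n ih =>
    refine wedgePow_succ_induction hx (fun u _ y hy ↦ ?_) fun x y hx hy ↦ ?_
    · rw [← mul_assoc, mul_ι_of_mem_wedgePow u 2 hw, mul_assoc _ y, ← ih hy]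
      simp [mul_assoc]
    · rw [mul_add, add_mul, hx, hy]

/-- The interior product with a linear functional. -/
def interiorProduct (d : Module.Dual k V) : ExteriorAlgebra k V →ₗ[k] ExteriorAlgebra k V :=
  CliffordAlgebra.contractLeft (Q := (0 : QuadraticForm k V)) d

lemma interiorProduct_ι_mul (d : Module.Dual k V) (v : V) (x : ExteriorAlgebra k V) :
    interiorProduct d (ExteriorAlgebra.ι k v * x) =
      d v • x - ExteriorAlgebra.ι k v * interiorProduct d x :=
  CliffordAlgebra.contractLeft_ι_mul d v x

lemma interiorProduct_algebraMap (d : Module.Dual k V) (c : k) :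
    interiorProduct d (algebraMap k (ExteriorAlgebra k V) c) = 0 :=
  CliffordAlgebra.contractLeft_algebraMap (0 : QuadraticForm k V) d c

lemma interiorProduct_mem_wedgePow (d : Module.Dual k V) (n : ℕ) {x : ExteriorAlgebra k V}
    (hx : x ∈ wedgePow U (n + 1)) : interiorProduct d x ∈ wedgePow U n := by
  induction n generalizing x with
  | zero =>
    refine wedgePow_succ_induction hx (fun u _ y hy ↦ ?_) fun x y hx hy ↦ ?_
    · obtain ⟨c, rfl⟩ := exists_algebraMap_eq_of_mem_wedgePow_zero hy
      rw [interiorProduct_ι_mul, interiorProduct_algebraMap, mul_zero, sub_zero]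
      exact Submodule.smul_mem _ _ hy
    · rw [map_add]
      exact add_mem hx hy
  | succ n ih =>
    refine wedgePow_succ_induction hx (fun u hu y hy ↦ ?_) fun x y hx hy ↦ ?_
    · rw [interiorProduct_ι_mul]
      exact sub_mem (Submodule.smul_mem _ _ hy) (ι_mul_mem_wedgePow hu (ih hy))
    · rw [map_add]
      exact add_mem hx hy

lemma interiorProduct_eq_zero {d : Module.Dual k V} (hd : ∀ u ∈ U, d u = 0) (n : ℕ)
    {x : ExteriorAlgebra k V} (hx : x ∈ wedgePow U n) : interiorProduct d x = 0 := by
  induction n generalizing x with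
  | zero =>
    obtain ⟨c, rfl⟩ := exists_algebraMap_eq_of_mem_wedgePow_zero hx
    exact interiorProduct_algebraMap d c
  | succ n ih =>
    refine wedgePow_succ_induction hx (fun u hu y hy ↦ ?_) fun x y hx hy ↦ ?_
    · rw [interiorProduct_ι_mul, hd u hu, ih hy, zero_smul, mul_zero, sub_zero]
    · rw [map_add, hx, hy, add_zero]

/-- A multivector of degree `m` killed by `m + 1` linearly independent vectors vanishes. -/
lemma eq_zero_of_ι_mul_eq_zero {m : ℕ} {u : Fin (m + 1) → V} (hu : LinearIndependent k u)
    {x : ExteriorAlgebra k V} (hx : x ∈ wedgePow U m)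
    (hux : ∀ i, ExteriorAlgebra.ι k (u i) * x = 0) : x = 0 := by
  induction m generalizing x with
  | zero =>
    obtain ⟨c, rfl⟩ := exists_algebraMap_eq_of_mem_wedgePow_zero hx
    have h := hux 0
    rw [← Algebra.commutes, ← Algebra.smul_def, ← map_smul, ExteriorAlgebra.ι_eq_zero_iff] at h
    rw [(smul_eq_zero.mp h).resolve_right (hu.ne_zero 0), map_zero]
  | succ m ih =>
    obtain ⟨htail, hnot⟩ := linearIndependent_finSucc.mp hu
    obtain ⟨d, hd0, hd⟩ := Submodule.exists_le_ker_of_notMem hnot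
    have hdx : interiorProduct d x = 0 := by
      refine ih htail (interiorProduct_mem_wedgePow d m hx) fun i ↦ ?_
      have h := interiorProduct_ι_mul d (u i.succ) x
      have hdi : d (u i.succ) = 0 := hd (Submodule.subset_span ⟨i, rfl⟩)
      rw [hux, map_zero, hdi, zero_smul, zero_sub] at h
      exact neg_eq_zero.mp h.symm
    have h := interiorProduct_ι_mul d (u 0) x
    rw [hux, map_zero, hdx, mul_zero, sub_zero] at h
    exact (smul_eq_zero.mp h.symm).resolve_left hd0

lemma eq_zero_of_forall_ι_mul_eq_zero [FiniteDimensional k U] {m : ℕ}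
    (hm : m < Module.finrank k U) {x : ExteriorAlgebra k V} (hx : x ∈ wedgePow U m)
    (hUx : ∀ u ∈ U, ExteriorAlgebra.ι k u * x = 0) : x = 0 := by
  have hli : LinearIndependent k fun i ↦ (Module.finBasis k U i : V) :=
    (Module.finBasis k U).linearIndependent.map' U.subtype U.ker_subtype
  exact eq_zero_of_ι_mul_eq_zero (hli.comp (Fin.castLE hm) (Fin.castLE_injective hm)) hx
    fun i ↦ hUx _ (Submodule.coe_mem _)

lemma eq_zero_of_forall_wedgePow_mul_eq_zero [FiniteDimensional k U] {m p : ℕ}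
    (hm : p + m ≤ Module.finrank k U) {x : ExteriorAlgebra k V} (hx : x ∈ wedgePow U m)
    (h : ∀ ξ ∈ wedgePow U p, ξ * x = 0) : x = 0 := by
  induction p with
  | zero => simpa using h 1 (by rw [wedgePow, pow_zero]; exact Submodule.one_le.mp le_rfl)
  | succ p ih =>
    refine ih (by omega) fun ξ hξ ↦ ?_
    refine eq_zero_of_forall_ι_mul_eq_zero (by omega) (mul_mem_wedgePow hξ hx) fun u hu ↦ ?_
    rw [← mul_assoc]
    exact h _ (ι_mul_mem_wedgePow hu hξ)

/-- Left multiplication by a vector outside `U` separates `⋀U` from its image. -/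
lemma eq_zero_of_add_ι_mul_mem {v : V} (hv : v ∉ U) {m n : ℕ} {ξ w : ExteriorAlgebra k V}
    (hw : w ∈ wedgePow U n) (hξ : ξ ∈ wedgePow U m)
    (h : ξ + ExteriorAlgebra.ι k v * w ∈ wedgePow U m) : w = 0 := by
  obtain ⟨d, hd0, hd⟩ := Submodule.exists_le_ker_of_notMem hv
  have h' := interiorProduct_eq_zero hd m h
  rw [map_add, interiorProduct_ι_mul, interiorProduct_eq_zero hd m hξ,
    interiorProduct_eq_zero hd n hw, mul_zero, sub_zero, zero_add] at h'
  exact (smul_eq_zero.mp h').resolve_left hd0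

lemma add_ι_mul_mul_add_ι_mul [FiniteDimensional k U] {v : V} {ξ ξ' w w' : ExteriorAlgebra k V}
    (hU : Module.finrank k U < 6)
    (hξ : ξ ∈ wedgePow U 3) (hξ' : ξ' ∈ wedgePow U 3)
    (hw : w ∈ wedgePow U 2) :
    (ξ + ExteriorAlgebra.ι k v * w) * (ξ' + ExteriorAlgebra.ι k v * w') =
      ExteriorAlgebra.ι k v * (ξ' * w - ξ * w') := by
  have hξξ' : ξ * ξ' = 0 := by
    have h := mul_mem_wedgePow hξ hξ'
    rwa [wedgePow_eq_bot hU, Submodule.mem_bot] at h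
  have hξv : ξ * ExteriorAlgebra.ι k v = -(ExteriorAlgebra.ι k v * ξ) := by
    simpa [pow_succ] using mul_ι_of_mem_wedgePow v 3 hξ
  have hwv : w * ExteriorAlgebra.ι k v = ExteriorAlgebra.ι k v * w := by
    simpa using mul_ι_of_mem_wedgePow v 2 hw
  have hvwvw' : ExteriorAlgebra.ι k v * w * (ExteriorAlgebra.ι k v * w') = 0 := by
    rw [mul_assoc, ← mul_assoc w, hwv, ← mul_assoc, ← mul_assoc, ExteriorAlgebra.ι_sq_zero,
      zero_mul, zero_mul]
  rw [add_mul, mul_add, mul_add, hξξ', hvwvw', ← mul_assoc ξ, hξv, mul_assoc _ w,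
    mul_comm_of_mem_wedgePow_two hw hξ']
  noncomm_ring

end WedgePow

/-- **GM datum to Lagrangian datum.**  Given an `n`-dimensional GM datum
`(V₆, V₅, W, q, ε)` over a field of characteristic `≠ 2` (where `ε` is a linear functional
restricting to an isomorphism `⋀⁵V₅ ≅ k`), and `v₀ ∈ V₆ ∖ V₅`, the subset
`A = {ξ + v₀∧w : ξ ∈ ⋀³V₅, w ∈ W, ε(ξ∧w″) + q(v₀)(w,w″) = 0 ∀ w″ ∈ W}` of `⋀³V₆` is a
linear subspace of dimension `10`, Lagrangian (`a∧a′ = 0` for all `a, a′ ∈ A`), with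
`dim (A ∩ ⋀³V₅) = 5 − n`. -/
theorem gm_datum_to_lagrangian
    {k V₆ : Type*} [Field k] [AddCommGroup V₆] [Module k V₆]
    (hchar : ringChar k ≠ 2) {n : ℕ} (hn : n = 3 ∨ n = 4 ∨ n = 5)
    (hdim6 : Module.finrank k V₆ = 6)
    (V₅ : Submodule k V₆) (hdim5 : Module.finrank k V₅ = 5)
    (W : Submodule k (ExteriorAlgebra k V₆)) (hW2 : W ≤ wedgePow V₅ 2)
    (hWdim : Module.finrank k W = n + 5)
    (ε : ExteriorAlgebra k V₆ →ₗ[k] k)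
    (hεinj : ∀ x ∈ wedgePow V₅ 5, ε x = 0 → x = 0)
    (hεsurj : ∀ c : k, ∃ x ∈ wedgePow V₅ 5, ε x = c)
    (q : V₆ →ₗ[k] W →ₗ[k] W →ₗ[k] k)
    (hqsymm : ∀ (v : V₆) (w w' : W), q v w w' = q v w' w)
    (hqcomp : ∀ v ∈ V₅, ∀ w w' : W,
      q v w w' = ε (ExteriorAlgebra.ι k v * (w : ExteriorAlgebra k V₆) *
        (w' : ExteriorAlgebra k V₆)))
    (v₀ : V₆) (hv₀ : v₀ ∉ V₅) :
    ∃ A : Submodule k (ExteriorAlgebra k V₆),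
      (A : Set (ExteriorAlgebra k V₆)) =
        {x | ∃ ξ ∈ wedgePow V₅ 3, ∃ w : W,
          x = ξ + ExteriorAlgebra.ι k v₀ * (w : ExteriorAlgebra k V₆) ∧
          ∀ w'' : W, ε (ξ * (w'' : ExteriorAlgebra k V₆)) + q v₀ w w'' = 0} ∧
      A ≤ wedgePow (⊤ : Submodule k V₆) 3 ∧
      Module.finrank k A = 10 ∧
      (∀ a ∈ A, ∀ a' ∈ A, a * a' = 0) ∧
      Module.finrank k ↥(A ⊓ wedgePow V₅ 3) = 5 - n := by
  have : FiniteDimensional k V₅ := Module.finite_of_finrank_pos (by omega)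
  have : FiniteDimensional k W := Module.finite_of_finrank_pos (by omega)
  let B : wedgePow V₅ 3 →ₗ[k] Module.Dual k W :=
    ((LinearMap.mul k (ExteriorAlgebra k V₆)).compr₂ ε).domRestrict₁₂ (wedgePow V₅ 3) W
  have hB (ξ : wedgePow V₅ 3) (w : W) :
      B ξ w = ε ((ξ : ExteriorAlgebra k V₆) * (w : ExteriorAlgebra k V₆)) := rfl
  have hBsurj : Function.Surjective B := by
    rw [← LinearMap.flip_injective_iff₁, injective_iff_map_eq_zero]
    intro w hw
    refine Subtype.ext (eq_zero_of_forall_wedgePow_mul_eq_zero (p := 3) hdim5.ge (hW2 w.2) ?_)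
    exact fun ξ hξ ↦ hεinj _ (mul_mem_wedgePow hξ (hW2 w.2)) (LinearMap.congr_fun hw ⟨ξ, hξ⟩)
  have hdim3 : Module.finrank k (wedgePow V₅ 3) = 10 := by
    rw [finrank_wedgePow, hdim5]
    rfl
  let F : (wedgePow V₅ 3 × W) →ₗ[k] Module.Dual k W := B.coprod (q v₀)
  have hFsurj : Function.Surjective F := fun f ↦ by
    obtain ⟨ξ, rfl⟩ := hBsurj f
    exact ⟨(ξ, 0), by simp [F]⟩
  let J : (wedgePow V₅ 3 × W) →ₗ[k] ExteriorAlgebra k V₆ :=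
    (wedgePow V₅ 3).subtype.coprod
      ((LinearMap.mulLeft k (ExteriorAlgebra.ι k v₀)).comp W.subtype)
  have hJ (p : wedgePow V₅ 3 × W) :
      J p = (p.1 : ExteriorAlgebra k V₆) +
        ExteriorAlgebra.ι k v₀ * (p.2 : ExteriorAlgebra k V₆) := by
    simp [J]
  have hJsnd (p : wedgePow V₅ 3 × W) (hp : J p ∈ wedgePow V₅ 3) : p.2 = 0 :=
    Subtype.ext (eq_zero_of_add_ι_mul_mem hv₀ (hW2 p.2.2) p.1.2 (hJ p ▸ hp))
  have hJinj : Function.Injective J := by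
    rw [injective_iff_map_eq_zero]
    intro p hp
    have hp2 := hJsnd p (hp ▸ zero_mem _)
    rw [hJ, hp2] at hp
    exact Prod.ext (Subtype.ext (by simpa using hp)) hp2
  have hFker (p : wedgePow V₅ 3 × W) : p ∈ LinearMap.ker F ↔
      ∀ w : W, ε ((p.1 : ExteriorAlgebra k V₆) * (w : ExteriorAlgebra k V₆)) + q v₀ p.2 w = 0 := by
    rw [LinearMap.mem_ker, LinearMap.ext_iff]
    simp [F, hB]
  refine ⟨(LinearMap.ker F).map J, ?_, ?_, ?_, ?_, ?_⟩
  · ext x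
    constructor
    · rintro ⟨p, hp, rfl⟩
      exact ⟨p.1, p.1.2, p.2, hJ p, (hFker p).mp hp⟩
    · rintro ⟨ξ, hξ, w, rfl, h⟩
      exact ⟨(⟨ξ, hξ⟩, w), (hFker _).mpr h, hJ _⟩
  · rintro _ ⟨p, -, rfl⟩
    rw [hJ]
    exact add_mem (wedgePow_mono le_top 3 p.1.2)
      (ι_mul_mem_wedgePow trivial (wedgePow_mono le_top 2 (hW2 p.2.2)))
  · have h := F.finrank_range_add_finrank_ker
    rw [LinearMap.range_eq_top.mpr hFsurj, finrank_top, Subspace.dual_finrank_eq,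
      Module.finrank_prod, hdim3] at h
    rw [← (Submodule.equivMapOfInjective _ hJinj _).finrank_eq]
    omega
  · rintro _ ⟨p, hp, rfl⟩ _ ⟨p', hp', rfl⟩
    have h := (hFker p).mp hp p'.2
    have h' := (hFker p').mp hp' p.2
    rw [hJ, hJ, add_ι_mul_mul_add_ι_mul (by omega) p.1.2 p'.1.2 (hW2 p.2.2)]
    rw [hεinj _ (sub_mem (mul_mem_wedgePow p'.1.2 (hW2 p.2.2))
      (mul_mem_wedgePow p.1.2 (hW2 p'.2.2))), mul_zero]
    rw [map_sub]
    linear_combination h' - h + hqsymm v₀ p.2 p'.2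
  · have hA : (LinearMap.ker F).map J ⊓ wedgePow V₅ 3 =
        (LinearMap.ker B).map (wedgePow V₅ 3).subtype := by
      ext x
      constructor
      · rintro ⟨⟨⟨ξ, w⟩, hp, rfl⟩, hx⟩
        obtain rfl : w = 0 := hJsnd _ hx
        exact ⟨ξ, by simpa [F] using hp, by simp [J]⟩
      · rintro ⟨ξ, hξ, rfl⟩
        exact ⟨⟨(ξ, 0), by simpa [F] using hξ, by simp [J]⟩, ξ.2⟩
    have h := B.finrank_range_add_finrank_ker
    rw [LinearMap.range_eq_top.mpr hBsurj, finrank_top, Subspace.dual_finrank_eq, hdim3] at h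
    rw [hA, ← (Submodule.equivMapOfInjective _ (wedgePow V₅ 3).subtype_injective _).finrank_eq]
    omega
end
end

section
/- Let p ≥ 5 be a prime number and let N be a 5×5 matrix with integer entries each of whose rows belongs to S. If N has rank 5 over ℚ (i.e., the image of N in 5×5 matrices over ℚ has rank 5), then the reduction of N modulo p has rank at least 4 over 𝔽_p. -/
/-- The set of 45 integer row vectors whose coordinates are a permutation of `(1,1,0,0,0)`,
of `(2,1,1,0,0)`, or of `(1,1,1,1,0)` (the rows of the matrix `E`). -/
def Srows : Set (Fin 5 → ℤ) :=
  {v | ∃ σ : Equiv.Perm (Fin 5),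
    v = ![1, 1, 0, 0, 0] ∘ σ ∨ v = ![2, 1, 1, 0, 0] ∘ σ ∨ v = ![1, 1, 1, 1, 0] ∘ σ}

/-- **Hadamard's inequality**: the determinant of a real matrix is bounded by the product of the
Euclidean norms of its rows. -/
theorem Matrix.det_sq_le_prod_sum_sq {n : ℕ} (A : Matrix (Fin n) (Fin n) ℝ) :
    A.det ^ 2 ≤ ∏ i, ∑ j, A i j ^ 2 := by
  have : Fact (Module.finrank ℝ (EuclideanSpace ℝ (Fin n)) = n) := ⟨by simp⟩
  let b := EuclideanSpace.basisFun (Fin n) ℝ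
  let v : Fin n → EuclideanSpace ℝ (Fin n) := fun i => WithLp.toLp 2 (A i)
  have hdet : b.toBasis.det v = A.det := by
    rw [Module.Basis.det_apply, ← Matrix.det_transpose]
    congr 1
  have h := b.toBasis.orientation.abs_volumeForm_apply_le v
  rw [Orientation.volumeForm_robust' _ b, hdet] at h
  calc A.det ^ 2 = |A.det| ^ 2 := (sq_abs _).symm
    _ ≤ (∏ i, ‖v i‖) ^ 2 := by gcongr
    _ = ∏ i, ∑ j, A i j ^ 2 := by
      simp [← Finset.prod_pow, EuclideanSpace.norm_sq_eq, v]

/-- The integer form of Hadamard's inequality. -/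
theorem Matrix.int_det_sq_le_prod_sum_sq {n : ℕ} (A : Matrix (Fin n) (Fin n) ℤ) :
    A.det ^ 2 ≤ ∏ i, ∑ j, A i j ^ 2 := by
  have h := (A.map (Int.cast : ℤ → ℝ)).det_sq_le_prod_sum_sq
  rw [← Int.cast_det] at h
  simp only [Matrix.map_apply] at h
  exact_mod_cast h

/-- The corank of a square integer matrix modulo a prime `p` bounds from below the power of `p`
dividing its determinant. -/
theorem Matrix.pow_corank_dvd_det {n p : ℕ} (hp : p.Prime) (N : Matrix (Fin n) (Fin n) ℤ) :
    (p : ℤ) ^ (n - (N.map (Int.cast : ℤ → ZMod p)).rank) ∣ N.det := by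
  have : Fact p.Prime := ⟨hp⟩
  obtain ⟨L, L', D, hD⟩ := Matrix.Pivot.exists_list_transvec_mul_mul_list_transvec_eq_diagonal
    (N.map (Int.cast : ℤ → ZMod p))
  set P := (L.map Matrix.TransvectionStruct.toMatrix).prod
  set Q := (L'.map Matrix.TransvectionStruct.toMatrix).prod
  have hPdet : P.det = 1 := Matrix.TransvectionStruct.det_toMatrix_prod L
  have hQdet : Q.det = 1 := Matrix.TransvectionStruct.det_toMatrix_prod L'
  have hlift : ∀ A : Matrix (Fin n) (Fin n) (ZMod p), A.det = 1 →
      ∃ B : Matrix (Fin n) (Fin n) ℤ, B.map (Int.cast : ℤ → ZMod p) = A ∧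
        IsCoprime (p : ℤ) B.det := by
    intro A hA
    refine ⟨A.map fun x => (x.val : ℤ), by ext; simp, ?_⟩
    rw [(Nat.prime_iff_prime_int.mp hp).coprime_iff_not_dvd, ← ZMod.intCast_zmod_eq_zero_iff_dvd,
      Int.cast_det]
    have : (A.map fun x => (x.val : ℤ)).map (Int.cast : ℤ → ZMod p) = A := by ext; simp
    rw [this, hA]
    exact one_ne_zero
  obtain ⟨P', hP', hPc⟩ := hlift P hPdet
  obtain ⟨Q', hQ', hQc⟩ := hlift Q hQdet
  have hM : (P' * N * Q').map (Int.cast : ℤ → ZMod p) = Matrix.diagonal D := by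
    rw [← hD, ← hP', ← hQ']
    simp only [← Int.coe_castRingHom, Matrix.map_mul]
  have hrank : (N.map (Int.cast : ℤ → ZMod p)).rank = Fintype.card {i // D i ≠ 0} := by
    rw [← Matrix.rank_diagonal, ← hD, Matrix.rank_mul_eq_left_of_isUnit_det _ _ (by simp [hQdet]),
      Matrix.rank_mul_eq_right_of_isUnit_det _ _ (by simp [hPdet])]
  have hrow : ∀ i j, ∃ c, (P' * N * Q') i j = (if D i = 0 then (p : ℤ) else 1) * c := by
    intro i j
    split_ifs with hi
    · have h := congrFun (congrFun hM i) j
      rw [Matrix.map_apply] at h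
      refine (ZMod.intCast_zmod_eq_zero_iff_dvd _ p).mp (h.trans ?_)
      by_cases hij : i = j
      · simp [← hij, hi]
      · simp [hij]
    · exact ⟨_, (one_mul _).symm⟩
  choose C hC using hrow
  have hfac : P' * N * Q' = Matrix.diagonal (fun i => if D i = 0 then (p : ℤ) else 1) *
      Matrix.of C := by
    ext i j
    rw [Matrix.diagonal_mul, hC, Matrix.of_apply]
  have hdvd : (p : ℤ) ^ (n - (N.map (Int.cast : ℤ → ZMod p)).rank) ∣ (P' * N * Q').det := by
    rw [hfac, Matrix.det_mul, Matrix.det_diagonal, Finset.prod_ite]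
    have hcard : n - (N.map (Int.cast : ℤ → ZMod p)).rank =
        (Finset.univ.filter fun i => D i = 0).card := by
      have := Finset.card_filter_add_card_filter_not (s := Finset.univ) (fun i => D i = 0)
      rw [hrank, Fintype.card_subtype]
      simp only [Finset.card_univ, Fintype.card_fin] at this
      simp only [ne_eq]
      omega
    simp [hcard]
  rw [Matrix.det_mul, Matrix.det_mul] at hdvd
  exact (hPc.pow_left.dvd_of_dvd_mul_left (hQc.pow_left.dvd_of_dvd_mul_right hdvd))

theorem even_sum_of_mem_Srows {v : Fin 5 → ℤ} (hv : v ∈ Srows) : Even (∑ j, v j) := by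
  obtain ⟨σ, rfl | rfl | rfl⟩ := hv <;>
  · simp only [Function.comp_apply]
    rw [Equiv.sum_comp σ]
    decide

/-- The image of a row under the symmetric matrix `10 - J`, where `J` is the all-ones matrix, has
squared length at most `360`. -/
theorem sum_sq_le_of_mem_Srows {v : Fin 5 → ℤ} (hv : v ∈ Srows) :
    ∑ j, (10 * v j - ∑ k, v k) ^ 2 ≤ 360 := by
  have hperm : ∀ (w : Fin 5 → ℤ) (σ : Equiv.Perm (Fin 5)),
      ∑ j, (10 * (w ∘ σ) j - ∑ k, (w ∘ σ) k) ^ 2 = ∑ j, (10 * w j - ∑ k, w k) ^ 2 := by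
    intro w σ
    simp only [Function.comp_apply]
    rw [Equiv.sum_comp σ w]
    exact Equiv.sum_comp σ fun j => (10 * w j - ∑ k, w k) ^ 2
  obtain ⟨σ, rfl | rfl | rfl⟩ := hv <;>
  · rw [hperm]
    decide

theorem two_dvd_det_of_rows_mem_Srows {N : Matrix (Fin 5) (Fin 5) ℤ} (hN : ∀ i, N i ∈ Srows) :
    2 ∣ N.det := by
  have h : (N.map (Int.cast : ℤ → ZMod 2)).det = 0 := by
    refine Matrix.exists_mulVec_eq_zero_iff.mp ⟨1, one_ne_zero, ?_⟩
    ext i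
    simp only [Matrix.mulVec, dotProduct, Matrix.map_apply, Pi.one_apply, mul_one, Pi.zero_apply]
    rw [← Int.cast_sum]
    exact (ZMod.intCast_zmod_eq_zero_iff_dvd _ 2).mpr (even_sum_of_mem_Srows (hN i)).two_dvd
  rw [← Int.cast_det] at h
  exact (ZMod.intCast_zmod_eq_zero_iff_dvd _ 2).mp h

theorem abs_det_lt_of_rows_mem_Srows {N : Matrix (Fin 5) (Fin 5) ℤ} (hN : ∀ i, N i ∈ Srows) :
    |N.det| < 50 := by
  let T : Matrix (Fin 5) (Fin 5) ℤ := Matrix.of fun i j => if i = j then 9 else -1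
  have hT : T.det = 50000 := by
    simp [T, Matrix.det_succ_row_zero, Fin.sum_univ_succ, Fin.succAbove]
  have hrow : ∀ i j, (N * T) i j = 10 * N i j - ∑ k, N i k := by
    intro i j
    rw [Matrix.mul_apply]
    fin_cases j <;> simp [T, Fin.sum_univ_five] <;> ring
  have h : (N.det * 50000) ^ 2 ≤ 360 ^ 5 := by
    calc (N.det * 50000) ^ 2 = (N * T).det ^ 2 := by rw [Matrix.det_mul, hT]
      _ ≤ ∏ i, ∑ j, (N * T) i j ^ 2 := (N * T).int_det_sq_le_prod_sum_sq
      _ ≤ ∏ _i : Fin 5, 360 := by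
        refine Finset.prod_le_prod (fun i _ => Finset.sum_nonneg fun j _ => sq_nonneg _)
          fun i _ => ?_
        simp only [hrow]
        exact sum_sq_le_of_mem_Srows (hN i)
      _ = 360 ^ 5 := by rw [Finset.prod_const, Finset.card_univ, Fintype.card_fin]
  refine abs_lt_of_sq_lt_sq ?_ (by norm_num)
  linarith

/-- If `p ≥ 5` is prime and `N` is a `5×5` integer matrix all of whose rows belong to `S`,
and `N` has rank `5` over `ℚ`, then the reduction of `N` mod `p` has rank at least `4`
over `𝔽_p`. -/
theorem rank_mod_p_ge_four
    {p : ℕ} (hp : p.Prime) (hp5 : 5 ≤ p)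
    (N : Matrix (Fin 5) (Fin 5) ℤ) (hN : ∀ i, N i ∈ Srows)
    (hrk : (N.map (Int.cast : ℤ → ℚ)).rank = 5) :
    4 ≤ (N.map (Int.cast : ℤ → ZMod p)).rank := by
  have hdet : N.det ≠ 0 := by
    intro h0
    have hQ : (N.map (Int.cast : ℤ → ℚ)).det = 0 := by rw [← Int.cast_det, h0, Int.cast_zero]
    obtain ⟨v, hv, hNv⟩ := Matrix.exists_mulVec_eq_zero_iff.mpr hQ
    have htop : LinearMap.range (N.map (Int.cast : ℤ → ℚ)).mulVecLin = ⊤ :=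
      Submodule.eq_top_of_finrank_eq (hrk.trans (by simp))
    have hinj := LinearMap.injective_iff_surjective.mpr (LinearMap.range_eq_top.mp htop)
    exact hv (hinj (by simpa using hNv))
  by_contra! hlt
  have hsq : (p : ℤ) ^ 2 ∣ N.det := (pow_dvd_pow _ (by omega)).trans (N.pow_corank_dvd_det hp)
  have hcop : IsCoprime (2 : ℤ) ((p : ℤ) ^ 2) := by
    have : Nat.Coprime 2 p := (Nat.coprime_primes Nat.prime_two hp).mpr (by omega)
    exact (Nat.isCoprime_iff_coprime.mpr this).pow_right
  have hdvd := hcop.mul_dvd (two_dvd_det_of_rows_mem_Srows hN) hsq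
  have hle := Int.le_of_dvd (abs_pos.mpr hdet) ((dvd_abs _ _).mpr hdvd)
  have hlt50 := abs_det_lt_of_rows_mem_Srows hN
  have hp5' : (5 : ℤ) ≤ p := by exact_mod_cast hp5
  nlinarith
end
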